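/- arXiv:2003.07511 — 2 statements merged into one kernel-verified Lean document; each statement's English description precedes it below -/
import Mathlib

section
/- Let S be a Seidel matrix of order n ≥ 277 with smallest eigenvalue exactly −5. If the independence number α([S]) of the switching class of S satisfies α([S]) ≥ 49, then rk(S + 5I) ≥ 2n/3 + 1. -/
open Matrix

/-- A Seidel matrix: symmetric, zero diagonal, off-diagonal entries `±1`. -/
def IsSeidel {n : ℕ} (S : Matrix (Fin n) (Fin n) ℝ) : Prop :=
  S.IsSymm ∧ (∀ i, S i i = 0) ∧ ∀ i j, i ≠ j → S i j = 1 ∨ S i j = -1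

/-- Smallest eigenvalue of a real symmetric matrix (junk value `0` if not Hermitian). -/
noncomputable def minEig {m : Type*} [Fintype m] [DecidableEq m] (A : Matrix m m ℝ) : ℝ := by
  classical
  exact if hA : A.IsHermitian then ⨅ i, hA.eigenvalues i else 0

/-- Largest eigenvalue of a real symmetric matrix (junk value `0` if not Hermitian). -/
noncomputable def maxEig {m : Type*} [Fintype m] [DecidableEq m] (A : Matrix m m ℝ) : ℝ := by
  classical
  exact if hA : A.IsHermitian then ⨆ i, hA.eigenvalues i else 0

/-- The Seidel matrix of a simple graph `G`, i.e. `J - I - 2A(G)`: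
zero diagonal, `-1` on adjacent pairs, `1` on distinct non-adjacent pairs. -/
noncomputable def seidelOf {V : Type*} [Fintype V] (G : SimpleGraph V) : Matrix V V ℝ := by
  classical
  exact Matrix.of fun i j => if i = j then 0 else if G.Adj i j then -1 else 1

/-- Smallest eigenvalue of the Seidel matrix of a finite graph. -/
noncomputable def minSeidelEig {V : Type*} [Finite V] (G : SimpleGraph V) : ℝ := by
  classical
  letI := Fintype.ofFinite V
  exact minEig (seidelOf G)

/-- Spectral radius (largest adjacency eigenvalue) of a finite graph. -/
noncomputable def specRad {V : Type*} [Finite V] (G : SimpleGraph V) : ℝ := by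
  classical
  letI := Fintype.ofFinite V
  exact maxEig (G.adjMatrix ℝ)

/-- Switching equivalence: `T = D S D` for some diagonal `±1` matrix `D`. -/
def SwEquiv {n : ℕ} (S T : Matrix (Fin n) (Fin n) ℝ) : Prop :=
  ∃ ε : Fin n → ℝ, (∀ i, ε i = 1 ∨ ε i = -1) ∧
    T = Matrix.diagonal ε * S * Matrix.diagonal ε

/-- The switching graph of a Seidel matrix `S`: the graph on `2n` vertices whose Seidel
matrix is the block matrix `((S, I - S), (I - S, S))`, adjacency given by entries `-1`. -/
def switchGraph {n : ℕ} (S : Matrix (Fin n) (Fin n) ℝ) : SimpleGraph (Fin n ⊕ Fin n) :=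
  SimpleGraph.fromRel fun x y => Matrix.fromBlocks S (1 - S) (1 - S) S x y = -1

/-- Independence number of a graph. -/
noncomputable def indepNum {V : Type*} (G : SimpleGraph V) : ℕ := Gᶜ.cliqueNum

/-- The graph consisting of `t` disjoint copies of `K₂`. -/
def nK2 (t : ℕ) : SimpleGraph (Fin t × Fin 2) :=
  SimpleGraph.fromRel fun p q => p.1 = q.1

section core
open scoped Classical
variable {V : Type*} [Fintype V]

/-- real adjacency indicator -/
noncomputable def aa (G : SimpleGraph V) (i j : V) : ℝ := if G.Adj i j then 1 else 0

/-- quadratic form of `2I - A` -/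
noncomputable def QQ (G : SimpleGraph V) (u : V → ℝ) : ℝ :=
  2 * ∑ i, u i ^ 2 - ∑ i, ∑ j, aa G i j * (u i * u j)

/-- bilinear form of `2I - A` -/
noncomputable def CC (G : SimpleGraph V) (u v : V → ℝ) : ℝ :=
  ∑ i, u i * (2 * v i - ∑ j, aa G i j * v j)

/-- neighbours -/
noncomputable def nb (G : SimpleGraph V) (i : V) : Finset V := Finset.univ.filter (G.Adj i)

lemma mem_nb {G : SimpleGraph V} {i j : V} : j ∈ nb G i ↔ G.Adj i j := by simp [nb]

lemma aa_symm (G : SimpleGraph V) (i j : V) : aa G i j = aa G j i := by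
  simp [aa, G.adj_comm]

lemma aa_nonneg (G : SimpleGraph V) (i j : V) : 0 ≤ aa G i j := by
  unfold aa; split_ifs <;> norm_num

lemma sum_aa (G : SimpleGraph V) (i : V) (f : V → ℝ) :
    ∑ j, aa G i j * f j = ∑ j ∈ nb G i, f j := by
  simp [aa, nb, Finset.sum_filter]

lemma QQ_add (G : SimpleGraph V) (u v : V → ℝ) (a b : ℝ) :
    QQ G (fun i => a * u i + b * v i) = a ^ 2 * QQ G u + b ^ 2 * QQ G v + 2 * a * b * CC G u v := by
  have h1 : ∑ i, ∑ j, aa G i j * (v i * u j) = ∑ i, ∑ j, aa G i j * (u i * v j) := by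
    rw [Finset.sum_comm]
    refine Finset.sum_congr rfl fun i _ => Finset.sum_congr rfl fun j _ => ?_
    rw [aa_symm]; ring
  have h2 : CC G u v = 2 * ∑ i, u i * v i - ∑ i, ∑ j, aa G i j * (u i * v j) := by
    unfold CC
    rw [Finset.mul_sum, ← Finset.sum_sub_distrib]
    refine Finset.sum_congr rfl fun i _ => ?_
    rw [mul_sub, Finset.mul_sum]
    congr 1
    · ring
    · exact Finset.sum_congr rfl fun j _ => by ring
  have h3 : ∑ i, (a * u i + b * v i) ^ 2 = a ^ 2 * ∑ i, u i ^ 2 + b ^ 2 * ∑ i, v i ^ 2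
      + 2 * a * b * ∑ i, u i * v i := by
    simp only [Finset.mul_sum, ← Finset.sum_add_distrib]
    exact Finset.sum_congr rfl fun i _ => by ring
  have h4 : ∑ i, ∑ j, aa G i j * ((a * u i + b * v i) * (a * u j + b * v j))
      = a ^ 2 * ∑ i, ∑ j, aa G i j * (u i * u j) + b ^ 2 * ∑ i, ∑ j, aa G i j * (v i * v j)
        + a * b * ∑ i, ∑ j, aa G i j * (u i * v j) + a * b * ∑ i, ∑ j, aa G i j * (v i * u j) := by
    simp only [Finset.mul_sum, ← Finset.sum_add_distrib]
    exact Finset.sum_congr rfl fun i _ => Finset.sum_congr rfl fun j _ => by ring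
  rw [h2]
  unfold QQ
  rw [h3, h4, h1]
  ring

lemma QQ_abs (G : SimpleGraph V) (u : V → ℝ) : QQ G (fun i => |u i|) ≤ QQ G u := by
  unfold QQ
  have : ∑ i, ∑ j, aa G i j * (u i * u j) ≤ ∑ i, ∑ j, aa G i j * (|u i| * |u j|) := by
    refine Finset.sum_le_sum fun i _ => Finset.sum_le_sum fun j _ => ?_
    refine mul_le_mul_of_nonneg_left ?_ (aa_nonneg G i j)
    rw [← abs_mul]; exact le_abs_self _
  simp only [sq_abs]
  linarith

lemma loc_neg {G : SimpleGraph V} (hP : ∀ v : V → ℝ, 0 ≤ 2 * QQ G v + (∑ i, v i) ^ 2)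
    (u : V → ℝ) (hu : QQ G u < 0) (N : Finset V)
    (hN : ∀ i, u i ≠ 0 → i ∈ N ∧ ∀ j, G.Adj i j → j ∈ N)
    (v : V → ℝ) (hv : QQ G v ≤ 0) (hvN : ∀ i ∈ N, v i = 0) : v = 0 := by
  by_contra hne
  have hpos : 0 < ∑ i, |v i| := by
    obtain ⟨i, hi⟩ := Function.ne_iff.mp hne
    exact Finset.sum_pos' (fun _ _ => abs_nonneg _) ⟨i, Finset.mem_univ _, abs_pos.mpr hi⟩
  have h1 := (QQ_abs G u).trans_lt hu
  have h2 := (QQ_abs G v).trans hv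
  set s := ∑ i, |u i|
  set a := ∑ i, |v i|
  have hC : CC G (fun i => |u i|) (fun i => |v i|) = 0 := by
    unfold CC
    refine Finset.sum_eq_zero fun i _ => ?_
    by_cases hi : u i = 0
    · simp [hi]
    · obtain ⟨hiN, hj⟩ := hN i hi
      have : ∑ j, aa G i j * |v j| = 0 := by
        rw [sum_aa]
        exact Finset.sum_eq_zero fun j hj' => by rw [hvN j (hj j (mem_nb.mp hj'))]; simp
      simp [this, hvN i hiN]
  have h3 := hP (fun i => a * |u i| + (-s) * |v i|)
  rw [QQ_add, hC] at h3
  have h4 : ∑ i, (a * |u i| + (-s) * |v i|) = 0 := by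
    rw [Finset.sum_add_distrib, ← Finset.mul_sum, ← Finset.mul_sum]
    change a * s + (-s) * a = 0
    ring
  rw [h4] at h3
  nlinarith [mul_pos (pow_pos hpos 2) (neg_pos.mpr h1), mul_nonneg (sq_nonneg s) (neg_nonneg.mpr h2)]

/-- the Gram matrix `4I + J - 2A` -/
noncomputable def MM (G : SimpleGraph V) : Matrix V V ℝ :=
  Matrix.of fun i j => (if i = j then 4 else 0) + 1 - 2 * aa G i j

lemma MM_mulVec (G : SimpleGraph V) (v : V → ℝ) (i : V) :
    (MM G *ᵥ v) i = 4 * v i + ∑ j, v j - 2 * ∑ j, aa G i j * v j := by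
  simp only [Matrix.mulVec, dotProduct, MM, Matrix.of_apply, sub_mul, add_mul, ite_mul, zero_mul,
    one_mul, Finset.sum_sub_distrib, Finset.sum_add_distrib, Finset.sum_ite_eq, Finset.mem_univ,
    if_true, Finset.mul_sum, mul_assoc]

lemma MM_form (G : SimpleGraph V) (v : V → ℝ) :
    v ⬝ᵥ (MM G *ᵥ v) = 2 * QQ G v + (∑ i, v i) ^ 2 := by
  simp only [dotProduct, MM_mulVec]
  unfold QQ
  have : ∀ i, v i * (4 * v i + ∑ j, v j - 2 * ∑ j, aa G i j * v j)
      = 4 * v i ^ 2 + v i * (∑ j, v j) - 2 * ∑ j, aa G i j * (v i * v j) := by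
    intro i
    have : ∑ j, aa G i j * (v i * v j) = v i * ∑ j, aa G i j * v j := by
      rw [Finset.mul_sum]; exact Finset.sum_congr rfl fun j _ => by ring
    rw [this]; ring
  simp only [this, Finset.sum_sub_distrib, Finset.sum_add_distrib, ← Finset.mul_sum,
    ← Finset.sum_mul]
  ring

lemma rank_ker (M : Matrix V V ℝ) :
    M.rank + Module.finrank ℝ (LinearMap.ker M.mulVecLin) = Fintype.card V := by
  have := LinearMap.finrank_range_add_finrank_ker M.mulVecLin
  rw [Module.finrank_fintype_fun_eq_card] at this
  exact this

lemma ker_bound_loc {G : SimpleGraph V} (hP : ∀ v : V → ℝ, 0 ≤ 2 * QQ G v + (∑ i, v i) ^ 2)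
    (u : V → ℝ) (hu : QQ G u < 0) (N : Finset V)
    (hN : ∀ i, u i ≠ 0 → i ∈ N ∧ ∀ j, G.Adj i j → j ∈ N) :
    Module.finrank ℝ (LinearMap.ker (MM G).mulVecLin) ≤ N.card := by
  let r : (V → ℝ) →ₗ[ℝ] (N → ℝ) := LinearMap.funLeft ℝ ℝ (fun x : N => (x : V))
  have hinj : Function.Injective (r.domRestrict (LinearMap.ker (MM G).mulVecLin)) := by
    rw [← LinearMap.ker_eq_bot, LinearMap.ker_eq_bot']
    rintro ⟨v, hv⟩ h
    have hv' : MM G *ᵥ v = 0 := hv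
    have hf := MM_form G v
    rw [hv', dotProduct_zero] at hf
    have := loc_neg hP u hu N hN v (by nlinarith [sq_nonneg (∑ i, v i)])
      (fun i hi => congrFun h ⟨i, hi⟩)
    exact Subtype.ext this
  have := LinearMap.finrank_le_finrank_of_injective hinj
  simpa using this

lemma closed_reach {G : SimpleGraph V} {P : V → Prop} (hP : ∀ i j, P i → G.Adj i j → P j)
    {i j : V} (h : G.Reachable i j) (hi : P i) : P j := by
  obtain ⟨w⟩ := h
  induction w with
  | nil => exact hi
  | cons hadj _ ih => exact ih (hP _ _ hi hadj)

lemma CC_single (G : SimpleGraph V) (w : V → ℝ) (i : V) :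
    CC G (Pi.single i 1) w = 2 * w i - ∑ j, aa G i j * w j := by
  unfold CC
  rw [Finset.sum_eq_single i]
  · simp
  · intro b _ hb; simp [hb]
  · simp

lemma QQ_single (G : SimpleGraph V) (i : V) : QQ G (Pi.single i 1) = 2 := by
  unfold QQ
  have : ∑ k, ∑ j, aa G k j * ((Pi.single i 1 : V → ℝ) k * (Pi.single i 1 : V → ℝ) j) = 0 := by
    refine Finset.sum_eq_zero fun k _ => Finset.sum_eq_zero fun j _ => ?_
    by_cases hk : k = i
    · by_cases hj : j = i
      · subst hk hj; simp [aa]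
      · simp [hj]
    · simp [hk]
  have h2 : ∑ k, (Pi.single i 1 : V → ℝ) k ^ 2 = 1 := by
    rw [Finset.sum_eq_single i]
    · simp
    · intro b _ hb; simp [hb]
    · simp
  rw [this, h2]; norm_num

lemma null_ker {G : SimpleGraph V} (hpos : ∀ u, 0 ≤ QQ G u) (w : V → ℝ) (hw : QQ G w ≤ 0) (i : V) :
    2 * w i = ∑ j, aa G i j * w j := by
  have h0 : QQ G w = 0 := le_antisymm hw (hpos w)
  have hC := CC_single G w i
  have he := QQ_single G i
  set e : V → ℝ := Pi.single i 1
  set c := CC G e w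
  have := hpos (fun k => (-c / 2) * e k + 1 * w k)
  rw [QQ_add, h0, he] at this
  have hc : c = 0 := by nlinarith [sq_nonneg c]
  linarith

lemma ker_bound_psd {G : SimpleGraph V} (hpos : ∀ u, 0 ≤ QQ G u) (hn : 3 ≤ Fintype.card V) :
    3 * Module.finrank ℝ (LinearMap.ker (MM G).mulVecLin) + 3 ≤ Fintype.card V := by
  let L : (V → ℝ) →ₗ[ℝ] (V → ℝ) :=
    (2 : ℝ) • LinearMap.id - (Matrix.of (aa G)).mulVecLin
  have hL : ∀ v, L v = 0 ↔ ∀ i, 2 * v i = ∑ j, aa G i j * v j := by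
    intro v
    rw [funext_iff]
    refine forall_congr' fun i => ?_
    simp only [L, LinearMap.sub_apply, LinearMap.smul_apply, LinearMap.id_apply, Pi.sub_apply,
      Pi.smul_apply, smul_eq_mul, Matrix.mulVecLin_apply, Matrix.mulVec, dotProduct,
      Matrix.of_apply, Pi.zero_apply]
    exact sub_eq_zero
  set K := LinearMap.ker (MM G).mulVecLin
  set V0 := LinearMap.ker L
  have hQ0 : ∀ v, L v = 0 → QQ G v = 0 := by
    intro v hv
    rw [hL] at hv
    unfold QQ
    rw [Finset.mul_sum, ← Finset.sum_sub_distrib]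
    refine Finset.sum_eq_zero fun i _ => ?_
    have : ∑ j, aa G i j * (v i * v j) = v i * ∑ j, aa G i j * v j := by
      rw [Finset.mul_sum]; exact Finset.sum_congr rfl fun j _ => by ring
    rw [this, ← hv i]; ring
  have habs : ∀ v, L v = 0 → ∀ i, 2 * |v i| = ∑ j, aa G i j * |v j| := by
    intro v hv
    exact null_ker hpos (fun i => |v i|) ((QQ_abs G v).trans (hQ0 v hv).le)
  have hKsum : ∀ v ∈ K, QQ G v = 0 ∧ ∑ i, v i = 0 := by
    intro v hv
    have hv' : MM G *ᵥ v = 0 := hv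
    have hf := MM_form G v
    rw [hv', dotProduct_zero] at hf
    have := hpos v
    constructor
    · nlinarith [sq_nonneg (∑ i, v i)]
    · have : (∑ i, v i) ^ 2 = 0 := by nlinarith [sq_nonneg (∑ i, v i)]
      exact pow_eq_zero_iff (two_ne_zero) |>.mp this
  have hKV : K ≤ V0 := fun v hv => (hL v).mpr (null_ker hpos v (hKsum v hv).1.le)
  by_cases hbot : V0 = ⊥
  · have : K = ⊥ := le_bot_iff.mp (hbot ▸ hKV)
    rw [this]; simpa using hn
  have hlt : K < V0 := by
    refine lt_of_le_of_ne hKV fun h => ?_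
    obtain ⟨v, hv, hv0⟩ := (Submodule.ne_bot_iff _).mp hbot
    have h1 : (fun i => |v i|) ∈ K := by
      rw [h]; exact (hL _).mpr (habs v hv)
    have h2 := (hKsum _ h1).2
    apply hv0
    funext i
    have := (Finset.sum_eq_zero_iff_of_nonneg (fun i _ => abs_nonneg (v i))).mp h2 i (Finset.mem_univ i)
    simpa using this
  have h1 := Submodule.finrank_lt_finrank_of_lt hlt
  -- components
  let cf : G.ConnectedComponent → Finset V :=
    fun c => Finset.univ.filter fun i => G.connectedComponentMk i = c
  let C := {c : G.ConnectedComponent // 3 ≤ (cf c).card}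
  have hprop : ∀ v, L v = 0 → ∀ i j, v i = 0 → G.Reachable i j → v j = 0 := by
    intro v hv i j hi hij
    refine closed_reach (P := fun i => v i = 0) ?_ hij hi
    intro k l hk hkl
    have h2 := habs v hv k
    rw [hk, abs_zero, mul_zero, sum_aa] at h2
    have := (Finset.sum_eq_zero_iff_of_nonneg (fun i _ => abs_nonneg (v i))).mp h2.symm l
      (mem_nb.mpr hkl)
    simpa using this
  have hsmall : ∀ v, L v = 0 → ∀ i, v i ≠ 0 → 3 ≤ (cf (G.connectedComponentMk i)).card := by
    intro v hv i hi
    by_contra hlt3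
    push Not at hlt3
    have hA := habs v hv
    have hex : ∃ j, G.Adj i j := by
      by_contra hno
      push Not at hno
      have h3 := hA i
      rw [sum_aa, Finset.sum_eq_zero (fun j hj => absurd (mem_nb.mp hj) (hno j))] at h3
      have := abs_pos.mpr hi
      linarith
    obtain ⟨j, hij⟩ := hex
    have hsub : ({i, j} : Finset V) ⊆ cf (G.connectedComponentMk i) := by
      intro k hk
      simp only [Finset.mem_insert, Finset.mem_singleton] at hk
      simp only [cf, Finset.mem_filter, Finset.mem_univ, true_and, SimpleGraph.ConnectedComponent.eq]
      rcases hk with rfl | rfl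
      · exact SimpleGraph.Reachable.refl _
      · exact hij.symm.reachable
    have heq := Finset.eq_of_subset_of_card_le hsub (by
      rw [Finset.card_pair hij.ne]; omega)
    have hin : ∀ k, G.Reachable k i → k = i ∨ k = j := by
      intro k hk
      have : k ∈ ({i, j} : Finset V) := by
        rw [heq]; simpa [cf] using hk
      simpa using this
    have hbd : ∀ k l, (∀ m, G.Adj k m → m = l) → ∑ m, aa G k m * |v m| ≤ |v l| := by
      intro k l h
      rw [sum_aa]
      have : nb G k ⊆ {l} := by
        intro m hm; simpa using h m (mem_nb.mp hm)
      calc _ ≤ ∑ m ∈ ({l} : Finset V), |v m| :=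
            Finset.sum_le_sum_of_subset_of_nonneg this (fun _ _ _ => abs_nonneg _)
        _ = _ := by simp
    have e1 := hbd i j (fun m hm => by
      rcases hin m hm.symm.reachable with h | h
      · subst h; exact absurd hm (G.loopless.irrefl _)
      · exact h)
    have e2 := hbd j i (fun m hm => by
      rcases hin m (hm.symm.reachable.trans hij.symm.reachable) with h | h
      · exact h
      · subst h; exact absurd hm (G.loopless.irrefl _))
    have := hA i
    have := hA j
    have := abs_pos.mpr hi
    linarith
  let r : (V → ℝ) →ₗ[ℝ] (C → ℝ) := LinearMap.funLeft ℝ ℝ (fun c : C => c.1.out)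
  have hinj : Function.Injective (r.domRestrict V0) := by
    rw [← LinearMap.ker_eq_bot, LinearMap.ker_eq_bot']
    rintro ⟨v, hv⟩ h
    refine Subtype.ext ?_
    funext i
    by_contra hi
    have h3 := hsmall v hv i hi
    have h4 : v (G.connectedComponentMk i).out = 0 := congrFun h ⟨G.connectedComponentMk i, h3⟩
    refine hi (hprop v hv _ i h4 ?_)
    exact SimpleGraph.ConnectedComponent.exact (Quot.out_eq (G.connectedComponentMk i))
  have h2 := LinearMap.finrank_le_finrank_of_injective hinj
  rw [Module.finrank_fintype_fun_eq_card] at h2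
  have h3 : 3 * Fintype.card C ≤ Fintype.card V := by
    have : ∑ c : C, 3 ≤ ∑ c : C, (cf c.1).card := Finset.sum_le_sum fun c _ => c.2
    have h5 : ∑ c : C, (cf c.1).card = ((Finset.univ : Finset C).biUnion fun c => cf c.1).card := by
      rw [Finset.card_biUnion]
      intro c _ d _ hcd
      rw [Function.onFun, Finset.disjoint_left]
      intro i hi hi'
      simp only [cf, Finset.mem_filter, Finset.mem_univ, true_and] at hi hi'
      exact hcd (Subtype.ext (hi.symm.trans hi'))
    have h6 := Finset.card_le_univ ((Finset.univ : Finset C).biUnion fun c => cf c.1)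
    simp at this
    omega
  omega

/-- every negative direction has large support -/
def NoLoc (G : SimpleGraph V) : Prop :=
  ∀ (u : V → ℝ) (N : Finset V), (∀ i, u i ≠ 0 → i ∈ N ∧ ∀ j, G.Adj i j → j ∈ N) →
    N.card ≤ 91 → 0 ≤ QQ G u

lemma cfg_closed {G : SimpleGraph V} (hloc : NoLoc G) (hdeg : ∀ i, (nb G i).card ≤ 9)
    {m : ℕ} (hm : m ≤ 9) (f : Fin m → V) (hf : Function.Injective f) (w : Fin m → ℕ)
    (es : List (Fin m × Fin m)) (hE : ∀ p ∈ es, G.Adj (f p.1) (f p.2))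
    (hw1 : ∀ s, 1 ≤ w s)
    (hasym : ∀ s t, (s, t) ∈ es → (t, s) ∉ es)
    (hwt : ∑ s, w s * w s ≤ ∑ s, ∑ t, if (s, t) ∈ es then w s * w t else 0)
    (hcon : ∀ s, ∃ t, (s, t) ∈ es ∨ (t, s) ∈ es) :
    ∀ s z, G.Adj (f s) z → ∃ t, f t = z := by
  intro s₀ z hz
  by_contra hno
  push Not at hno
  let u : V → ℝ := fun i => ∑ s, if f s = i then (w s : ℝ) else 0
  have hsum : ∀ F : V → ℝ, ∑ i, u i * F i = ∑ s, (w s : ℝ) * F (f s) := by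
    intro F
    simp only [u, Finset.sum_mul]
    rw [Finset.sum_comm]
    refine Finset.sum_congr rfl fun s _ => ?_
    simp
  have huf : ∀ s, u (f s) = w s := by
    intro s
    simp only [u, hf.eq_iff]
    simp
  have hQ : QQ G u = 2 * ∑ s, (w s : ℝ) * w s - ∑ s, ∑ t, aa G (f s) (f t) * ((w s : ℝ) * w t) := by
    unfold QQ
    congr 1
    · congr 1
      simp only [sq]
      rw [hsum]
      simp [huf]
    · have : ∀ i, ∑ j, aa G i j * (u i * u j) = u i * ∑ t, (w t : ℝ) * aa G i (f t) := by
        intro i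
        rw [← hsum, Finset.mul_sum]
        exact Finset.sum_congr rfl fun j _ => by ring
      simp only [this]
      rw [hsum]
      refine Finset.sum_congr rfl fun s _ => ?_
      rw [Finset.mul_sum]
      exact Finset.sum_congr rfl fun j _ => by ring
  have hge : ∀ s t, ((if (s, t) ∈ es then (w s * w t : ℝ) else 0)
      + if (t, s) ∈ es then (w t * w s : ℝ) else 0) ≤ aa G (f s) (f t) * ((w s : ℝ) * w t) := by
    intro s t
    by_cases h1 : (s, t) ∈ es
    · have := hE _ h1
      simp only at this
      simp [h1, hasym _ _ h1, aa, this]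
    · by_cases h2 : (t, s) ∈ es
      · have := (hE _ h2).symm
        simp only at this
        simp [h1, h2, aa, this, mul_comm]
      · simp only [h1, h2, if_false, add_zero]
        exact mul_nonneg (aa_nonneg _ _ _) (by positivity)
  have hQ0 : QQ G u ≤ 0 := by
    have h1 := Finset.sum_le_sum fun s (_ : s ∈ Finset.univ) =>
      Finset.sum_le_sum fun t (_ : t ∈ Finset.univ) => hge s t
    simp only [Finset.sum_add_distrib] at h1
    rw [Finset.sum_comm (f := fun s t => if (t, s) ∈ es then (w t * w s : ℝ) else 0)] at h1
    have h2 : (∑ s, (w s : ℝ) * w s) ≤ ∑ s, ∑ t, if (s, t) ∈ es then (w s * w t : ℝ) else 0 := by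
      exact_mod_cast hwt
    rw [hQ]
    linarith
  have huz : u z = 0 := by
    simp only [u]
    exact Finset.sum_eq_zero fun s _ => by simp [hno s]
  have hCz : CC G (Pi.single z 1) u ≤ -1 := by
    rw [CC_single, huz]
    have : ∑ j, aa G z j * u j = ∑ t, (w t : ℝ) * aa G z (f t) := by
      rw [← hsum]; exact Finset.sum_congr rfl fun j _ => by ring
    rw [this]
    have h1 : (w s₀ : ℝ) * aa G z (f s₀) ≤ ∑ t, (w t : ℝ) * aa G z (f t) :=
      Finset.single_le_sum (f := fun t => (w t : ℝ) * aa G z (f t))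
        (fun t _ => mul_nonneg (by positivity) (aa_nonneg _ _ _)) (Finset.mem_univ s₀)
    have h2 : aa G z (f s₀) = 1 := by simp [aa, hz.symm]
    have h3 : (1 : ℝ) ≤ w s₀ := by exact_mod_cast hw1 s₀
    rw [h2] at h1
    linarith
  set T : Finset V := insert z (Finset.univ.image f)
  have hTc : T.card ≤ 10 := by
    have h1 : T.card ≤ _ := Finset.card_insert_le z (Finset.univ.image f)
    have h2 := Finset.card_image_le (s := (Finset.univ : Finset (Fin m))) (f := f)
    simp at h2
    omega
  have hT : ∀ i, u i ≠ 0 → i ∈ T := by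
    intro i hi
    by_contra hiT
    apply hi
    simp only [u]
    refine Finset.sum_eq_zero fun s _ => ?_
    rw [if_neg]
    rintro rfl
    exact hiT (Finset.mem_insert_of_mem (Finset.mem_image_of_mem f (Finset.mem_univ s)))
  have hTT : ∀ i ∈ T, ∃ k ∈ T, G.Adj k i := by
    intro i hi
    rcases Finset.mem_insert.mp hi with rfl | hi
    · exact ⟨f s₀, Finset.mem_insert_of_mem (Finset.mem_image_of_mem f (Finset.mem_univ s₀)), hz⟩
    · obtain ⟨s, -, rfl⟩ := Finset.mem_image.mp hi
      obtain ⟨t, ht⟩ := hcon s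
      refine ⟨f t, Finset.mem_insert_of_mem (Finset.mem_image_of_mem f (Finset.mem_univ t)), ?_⟩
      rcases ht with ht | ht
      · exact (hE _ ht).symm
      · exact hE _ ht
  have hNc : (T.biUnion (nb G)).card ≤ 91 := by
    have := Finset.card_biUnion_le_card_mul T (nb G) 9 (fun i _ => hdeg i)
    omega
  have hfin := hloc (fun i => (1 / 2) * (Pi.single z 1 : V → ℝ) i + 1 * u i) (T.biUnion (nb G)) (by
    intro i hi
    have hiT : i ∈ T := by
      by_contra hiT
      apply hi
      have h1 : u i = 0 := by by_contra h; exact hiT (hT i h)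
      have h2 : i ≠ z := by rintro rfl; exact hiT (Finset.mem_insert_self _ _)
      simp [h1, h2]
    constructor
    · obtain ⟨k, hk, hki⟩ := hTT i hiT
      exact Finset.mem_biUnion.mpr ⟨k, hk, mem_nb.mpr hki⟩
    · intro j hj
      exact Finset.mem_biUnion.mpr ⟨i, hiT, mem_nb.mpr hj⟩) hNc
  rw [QQ_add, QQ_single] at hfin
  linarith

/-- the component of `i` is large -/
def Lg (G : SimpleGraph V) (i : V) : Prop :=
  ∀ T : Finset V, i ∈ T → (∀ k ∈ T, ∀ l, G.Adj k l → l ∈ T) → 92 ≤ T.card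

lemma cfg_false {G : SimpleGraph V} (hloc : NoLoc G) (hdeg : ∀ i, (nb G i).card ≤ 9)
    {m : ℕ} (hm : m ≤ 9) (f : Fin m → V) (hf : Function.Injective f) (s₀ : Fin m)
    (hL : Lg G (f s₀)) (w : Fin m → ℕ)
    (es : List (Fin m × Fin m)) (hE : ∀ p ∈ es, G.Adj (f p.1) (f p.2))
    (hw1 : ∀ s, 1 ≤ w s)
    (hasym : ∀ s t, (s, t) ∈ es → (t, s) ∉ es)
    (hwt : ∑ s, w s * w s ≤ ∑ s, ∑ t, if (s, t) ∈ es then w s * w t else 0)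
    (hcon : ∀ s, ∃ t, (s, t) ∈ es ∨ (t, s) ∈ es) : False := by
  have h := cfg_closed hloc hdeg hm f hf w es hE hw1 hasym hwt hcon
  have h1 := hL (Finset.univ.image f) (Finset.mem_image_of_mem f (Finset.mem_univ s₀)) (by
    intro k hk l hl
    obtain ⟨s, -, rfl⟩ := Finset.mem_image.mp hk
    obtain ⟨t, rfl⟩ := h s l hl
    exact Finset.mem_image_of_mem f (Finset.mem_univ t))
  have h2 := Finset.card_image_le (s := (Finset.univ : Finset (Fin m))) (f := f)
  simp at h2
  omega

lemma no_tri {G : SimpleGraph V} (hloc : NoLoc G) (hdeg : ∀ i, (nb G i).card ≤ 9)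
    {v a b : V} (hL : Lg G v) (h1 : G.Adj v a) (h2 : G.Adj v b) (h3 : G.Adj a b) : False := by
  refine cfg_false hloc hdeg (m := 3) (by norm_num) ![v, a, b] ?_ 0 (by simpa using hL)
    ![1, 1, 1] [(0, 1), (0, 2), (1, 2)] ?_ (by decide) (by decide) (by decide) (by decide)
  · rw [← List.nodup_ofFn]
    simp [h1.ne, h2.ne, h3.ne]
  · simp [h1, h2, h3]

lemma no_quad {G : SimpleGraph V} (hloc : NoLoc G) (hdeg : ∀ i, (nb G i).card ≤ 9)
    {v a b x : V} (hL : Lg G v) (h1 : G.Adj v a) (h2 : G.Adj v b) (h3 : G.Adj a x) (h4 : G.Adj b x)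
    (hab : a ≠ b) (hvx : v ≠ x) : False := by
  refine cfg_false hloc hdeg (m := 4) (by norm_num) ![v, a, b, x] ?_ 0 (by simpa using hL)
    ![1, 1, 1, 1] [(0, 1), (0, 2), (1, 3), (2, 3)] ?_ (by decide) (by decide) (by decide) (by decide)
  · rw [← List.nodup_ofFn]
    simp [h1.ne, h2.ne, h3.ne, h4.ne, hab, hvx]
  · simp [h1, h2, h3, h4]

lemma deg_le_three {G : SimpleGraph V} (hloc : NoLoc G) (hdeg : ∀ i, (nb G i).card ≤ 9)
    {v : V} (hL : Lg G v) : (nb G v).card ≤ 3 := by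
  by_contra hc
  push Not at hc
  obtain ⟨T, hT, hTc⟩ := Finset.exists_subset_card_eq (show 4 ≤ (nb G v).card from hc)
  obtain ⟨a, b, c, d, hab, hac, had, hbc, hbd, hcd, rfl⟩ := Finset.card_eq_four.mp hTc
  have ha : G.Adj v a := mem_nb.mp (hT (by simp))
  have hb : G.Adj v b := mem_nb.mp (hT (by simp))
  have hc' : G.Adj v c := mem_nb.mp (hT (by simp))
  have hd : G.Adj v d := mem_nb.mp (hT (by simp))
  refine cfg_false hloc hdeg (m := 5) (by norm_num) ![v, a, b, c, d] ?_ 0 (by simpa using hL)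
    ![2, 1, 1, 1, 1] [(0, 1), (0, 2), (0, 3), (0, 4)] ?_ (by decide) (by decide) (by decide)
    (by decide)
  · rw [← List.nodup_ofFn]
    simp [ha.ne, hb.ne, hc'.ne, hd.ne, hab, hac, had, hbc, hbd, hcd]
  · simp [ha, hb, hc', hd]

/-- balls around `v` -/
noncomputable def ball (G : SimpleGraph V) (v : V) : ℕ → Finset V
  | 0 => {v}
  | k + 1 => ball G v k ∪ (ball G v k).biUnion (nb G)

lemma ball_succ {G : SimpleGraph V} {v i : V} {k : ℕ} :
    i ∈ ball G v (k + 1) ↔ i ∈ ball G v k ∨ ∃ j ∈ ball G v k, G.Adj j i := by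
  simp [ball, mem_nb]

lemma ball_mono {G : SimpleGraph V} {v : V} {k l : ℕ} (h : k ≤ l) : ball G v k ⊆ ball G v l := by
  induction h with
  | refl => exact Finset.Subset.refl _
  | step _ ih => exact ih.trans fun i hi => ball_succ.mpr (Or.inl hi)

lemma Lg_adj {G : SimpleGraph V} {i j : V} (h : Lg G i) (hij : G.Adj i j) : Lg G j := by
  intro T hT hcl
  exact h T (hcl j hT i hij.symm) hcl

lemma ball_Lg {G : SimpleGraph V} {v : V} (h : Lg G v) (k : ℕ) : ∀ i ∈ ball G v k, Lg G i := by
  induction k with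
  | zero => intro i hi; simp [ball] at hi; exact hi ▸ h
  | succ k ih =>
    intro i hi
    rcases ball_succ.mp hi with hi | ⟨j, hj, hji⟩
    · exact ih i hi
    · exact Lg_adj (ih j hj) hji

lemma ball_step {G : SimpleGraph V} (hloc : NoLoc G) (hdeg : ∀ i, (nb G i).card ≤ 9)
    {v : V} (hL : Lg G v) (k : ℕ) :
    (ball G v (k + 2) \ ball G v (k + 1)).card ≤ (ball G v (k + 1) \ ball G v k).card * 2 := by
  have hsub : ball G v (k + 2) \ ball G v (k + 1) ⊆
      (ball G v (k + 1) \ ball G v k).biUnion fun i => nb G i \ ball G v (k + 1) := by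
    intro i hi
    obtain ⟨h1, h2⟩ := Finset.mem_sdiff.mp hi
    rcases ball_succ.mp h1 with h | ⟨j, hj, hji⟩
    · exact absurd h h2
    · refine Finset.mem_biUnion.mpr ⟨j, Finset.mem_sdiff.mpr ⟨hj, fun hj' => h2 ?_⟩,
        Finset.mem_sdiff.mpr ⟨mem_nb.mpr hji, h2⟩⟩
      exact ball_succ.mpr (Or.inr ⟨j, hj', hji⟩)
  refine (Finset.card_le_card hsub).trans (Finset.card_biUnion_le_card_mul _ _ _ ?_)
  intro i hi
  obtain ⟨h1, h2⟩ := Finset.mem_sdiff.mp hi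
  have h3 := deg_le_three hloc hdeg (ball_Lg hL _ i h1)
  rcases ball_succ.mp h1 with h | ⟨j, hj, hji⟩
  · exact absurd h h2
  · have : nb G i \ ball G v (k + 1) ⊂ nb G i := by
      refine (Finset.ssubset_iff_of_subset Finset.sdiff_subset).mpr ⟨j, mem_nb.mpr hji.symm, ?_⟩
      simp [ball_mono (Nat.le_succ k) hj]
    have := Finset.card_lt_card this
    omega

lemma ball_far {G : SimpleGraph V} (hloc : NoLoc G) (hdeg : ∀ i, (nb G i).card ≤ 9)
    {v : V} (hL : Lg G v) : ∃ p, p ∈ ball G v 5 ∧ p ∉ ball G v 4 := by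
  by_contra hno
  push Not at hno
  have h92 := hL (ball G v 4) (ball_mono (Nat.zero_le 4) (by simp [ball])) (by
    intro k hk l hl
    exact hno l (ball_succ.mpr (Or.inr ⟨k, hk, hl⟩)))
  have s1 := ball_step hloc hdeg hL 0
  have s2 := ball_step hloc hdeg hL 1
  have s3 := ball_step hloc hdeg hL 2
  have c0 : (ball G v 0).card = 1 := by simp [ball]
  have c1 : (ball G v 1 \ ball G v 0).card ≤ 3 := by
    refine (Finset.card_le_card ?_).trans (deg_le_three hloc hdeg hL)
    intro i hi
    obtain ⟨h1, h2⟩ := Finset.mem_sdiff.mp hi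
    rcases ball_succ.mp h1 with h | ⟨j, hj, hji⟩
    · exact absurd h h2
    · simp [ball] at hj; subst hj; exact mem_nb.mpr hji
  have d := fun k => Finset.card_sdiff_add_card_eq_card (ball_mono (G := G) (v := v) (Nat.le_succ k))
  have d0 := d 0
  have d1 := d 1
  have d2 := d 2
  have d3 := d 3
  simp only [Nat.succ_eq_add_one, Nat.reduceAdd] at *
  omega

lemma no_E8 {G : SimpleGraph V} (hloc : NoLoc G) (hdeg : ∀ i, (nb G i).card ≤ 9)
    {v c d d' p1 p2 p3 p4 p5 : V} (hL : Lg G v) (hc : G.Adj v c) (hd : G.Adj v d)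
    (hd' : G.Adj d d') (h1 : G.Adj v p1) (h2 : G.Adj p1 p2) (h3 : G.Adj p2 p3) (h4 : G.Adj p3 p4)
    (h5 : G.Adj p4 p5) (hcd : c ≠ d) (hcp : c ≠ p1) (hdp : d ≠ p1) (hd'v : d' ≠ v)
    (m2 : p2 ∈ ball G v 2) (n2 : p2 ∉ ball G v 1)
    (m3 : p3 ∈ ball G v 3) (n3 : p3 ∉ ball G v 2) (m4 : p4 ∈ ball G v 4) (n4 : p4 ∉ ball G v 3)
    (n5 : p5 ∉ ball G v 4) : False := by
  have bv : v ∈ ball G v 0 := by simp [ball]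
  have b1 : ∀ {x}, G.Adj v x → x ∈ ball G v 1 := fun hx => ball_succ.mpr (Or.inr ⟨v, bv, hx⟩)
  have bd' : d' ∈ ball G v 2 := ball_succ.mpr (Or.inr ⟨d, b1 hd, hd'⟩)
  have key : ∀ {k l : ℕ} {x y : V}, x ∈ ball G v k → k ≤ l → y ∉ ball G v l → x ≠ y := by
    rintro k l x y hx hkl hy rfl
    exact hy (ball_mono hkl hx)
  refine cfg_false hloc hdeg (m := 9) (by norm_num) ![v, c, d, d', p1, p2, p3, p4, p5] ?_ 0
    (by simpa using hL)
    ![6, 3, 4, 2, 5, 4, 3, 2, 1]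
    [(0, 1), (0, 2), (2, 3), (0, 4), (4, 5), (5, 6), (6, 7), (7, 8)] ?_ (by decide) (by decide)
    (by set_option maxRecDepth 100000 in decide) (by decide)
  · rw [← List.nodup_ofFn]
    have e1 : c ≠ d' := by rintro rfl; exact no_tri hloc hdeg hL hd hc hd'
    have e2 : d' ≠ p1 := by rintro rfl; exact no_tri hloc hdeg hL hd h1 hd'
    have e3 : d' ≠ p2 := by
      rintro rfl; exact no_quad hloc hdeg hL hd h1 hd' h2 hdp hd'v.symm
    simp [hc.ne, hd.ne, hd'v.symm, h1.ne, key bv (by norm_num) n2, key bv (by norm_num) n3,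
      key bv (by norm_num) n4, key bv (by norm_num) n5, hcd, e1, hcp, 
      key (b1 hc) le_rfl n2, key (b1 hc) (by norm_num) n3, key (b1 hc) (by norm_num) n4,
      key (b1 hc) (by norm_num) n5, hd'.ne, hdp,
      key (b1 hd) le_rfl n2, key (b1 hd) (by norm_num) n3, key (b1 hd) (by norm_num) n4,
      key (b1 hd) (by norm_num) n5, e2, e3, key bd' le_rfl n3, key bd' (by norm_num) n4,
      key bd' (by norm_num) n5, key (b1 h1) le_rfl n2, key (b1 h1) (by norm_num) n3,
      key (b1 h1) (by norm_num) n4,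
      key (b1 h1) (by norm_num) n5, h3.ne, key m2 (by norm_num) n4, key m2 (by norm_num) n5,
      h4.ne, key m3 (by norm_num) n5, h5.ne]
  · simp [hc, hd, hd', h1, h2, h3, h4, h5]

/-- weights witnessing positive semidefiniteness -/
noncomputable def zz (G : SimpleGraph V) (i : V) : ℝ :=
  if (nb G i).card = 1 ∧ ∃ w, G.Adj i w ∧ 3 ≤ (nb G w).card then 1 else 2

lemma zz_le (G : SimpleGraph V) (i : V) : zz G i ≤ 2 := by
  unfold zz; split_ifs <;> norm_num

lemma zz_pos (G : SimpleGraph V) (i : V) : 0 < zz G i := by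
  unfold zz; split_ifs <;> norm_num

lemma zz_ok {G : SimpleGraph V} (hloc : NoLoc G) (hdeg : ∀ i, (nb G i).card ≤ 9)
    {v : V} (hL : Lg G v) : ∑ j ∈ nb G v, zz G j ≤ 2 * zz G v := by
  have h3 := deg_le_three hloc hdeg hL
  have hcrude : ∑ j ∈ nb G v, zz G j ≤ (nb G v).card * 2 := by
    have := Finset.sum_le_card_nsmul (nb G v) (zz G) 2 (fun i _ => zz_le G i)
    simpa using this
  by_cases hz : (nb G v).card = 1 ∧ ∃ w, G.Adj v w ∧ 3 ≤ (nb G w).card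
  · have : zz G v = 1 := by simp [zz, hz]
    rw [this]
    rw [hz.1] at hcrude
    simpa using hcrude
  have hzv : zz G v = 2 := by simp only [zz, if_neg hz]
  rw [hzv]
  by_cases h2 : (nb G v).card ≤ 2
  · have : ((nb G v).card : ℝ) ≤ 2 := by exact_mod_cast h2
    linarith
  have hc3 : (nb G v).card = 3 := by omega
  obtain ⟨p5, m5, n5⟩ := ball_far hloc hdeg hL
  have back : ∀ {k : ℕ} {x : V}, x ∈ ball G v (k + 2) → x ∉ ball G v (k + 1) →
      ∃ y, y ∈ ball G v (k + 1) ∧ y ∉ ball G v k ∧ G.Adj y x := by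
    intro k x hx hx'
    rcases ball_succ.mp hx with h | ⟨y, hy, hyx⟩
    · exact absurd h hx'
    · exact ⟨y, hy, fun h => hx' (ball_succ.mpr (Or.inr ⟨y, h, hyx⟩)), hyx⟩
  obtain ⟨p4, m4, n4, a5⟩ := back m5 n5
  obtain ⟨p3, m3, n3, a4⟩ := back m4 n4
  obtain ⟨p2, m2, n2, a3⟩ := back m3 n3
  obtain ⟨p1, m1, n1, a2⟩ := back m2 n2
  have a1 : G.Adj v p1 := by
    rcases ball_succ.mp m1 with h | ⟨y, hy, hyx⟩
    · exact absurd h n1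
    · simp [ball] at hy; exact hy ▸ hyx
  have hp1 : p1 ∈ nb G v := mem_nb.mpr a1
  have hcc : ((nb G v).erase p1).card = 2 := by rw [Finset.card_erase_of_mem hp1, hc3]
  obtain ⟨c, d, hcd, hcdeq⟩ := Finset.card_eq_two.mp hcc
  have hcm : c ∈ (nb G v).erase p1 := by rw [hcdeq]; simp
  have hdm : d ∈ (nb G v).erase p1 := by rw [hcdeq]; simp
  obtain ⟨hcp, hc⟩ := Finset.mem_erase.mp hcm
  obtain ⟨hdp, hd⟩ := Finset.mem_erase.mp hdm
  rw [mem_nb] at hc hd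
  have leaf : ∀ {x y : V}, x ≠ y → G.Adj v x → G.Adj v y → x ≠ p1 → y ≠ p1 → zz G y = 1 := by
    intro x y hxy hx hy hxp hyp
    have : (nb G y).card = 1 := by
      by_contra hne
      have hv : v ∈ nb G y := mem_nb.mpr hy.symm
      have hpos : 0 < (nb G y).card := Finset.card_pos.mpr ⟨v, hv⟩
      obtain ⟨d', hd', hne'⟩ := Finset.exists_mem_ne (show 1 < (nb G y).card by omega) v
      exact no_E8 hloc hdeg hL hx hy (mem_nb.mp hd') a1 a2 a3 a4 a5 hxy hxp hyp hne'
        m2 n2 m3 n3 m4 n4 n5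
    unfold zz
    rw [if_pos ⟨this, v, hy.symm, by omega⟩]
  rw [← Finset.add_sum_erase _ _ hp1, hcdeq, Finset.sum_pair hcd, leaf hcd hc hd hcp hdp,
    leaf hcd.symm hd hc hdp hcp]
  linarith [zz_le G p1]

lemma QQ_of_z {G : SimpleGraph V} (z : V → ℝ) (hz : ∀ i, 0 < z i) (u : V → ℝ)
    (h : ∀ i, u i ≠ 0 → ∑ j ∈ nb G i, z j ≤ 2 * z i) : 0 ≤ QQ G u := by
  unfold QQ
  have key : ∀ i j, aa G i j * (u i * u j) ≤
      aa G i j * (u i ^ 2 / z i * z j) / 2 + aa G j i * (u j ^ 2 / z j * z i) / 2 := by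
    intro i j
    rw [aa_symm G j i]
    have h1 : u i * u j ≤ (u i ^ 2 / z i * z j) / 2 + (u j ^ 2 / z j * z i) / 2 := by
      have hi := hz i
      have hj := hz j
      have : (u i ^ 2 / z i * z j) / 2 + (u j ^ 2 / z j * z i) / 2 - u i * u j
          = z i * z j * (u i / z i - u j / z j) ^ 2 / 2 := by
        field_simp
        ring
      have h2 : 0 ≤ z i * z j * (u i / z i - u j / z j) ^ 2 / 2 := by positivity
      linarith
    nlinarith [mul_le_mul_of_nonneg_left h1 (aa_nonneg G i j)]
  have hs := Finset.sum_le_sum fun i (_ : i ∈ Finset.univ) =>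
    Finset.sum_le_sum fun j (_ : j ∈ Finset.univ) => key i j
  simp only [Finset.sum_add_distrib] at hs
  rw [Finset.sum_comm (f := fun i j => aa G j i * (u j ^ 2 / z j * z i) / 2)] at hs
  have h4 : ∑ i, ∑ j, aa G i j * (u i ^ 2 / z i * z j) / 2 ≤ ∑ i, u i ^ 2 := by
    refine Finset.sum_le_sum fun i _ => ?_
    have : ∑ j, aa G i j * (u i ^ 2 / z i * z j) / 2 = u i ^ 2 / z i / 2 * ∑ j ∈ nb G i, z j := by
      rw [← sum_aa, Finset.mul_sum]
      exact Finset.sum_congr rfl fun j _ => by ring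
    rw [this]
    by_cases hu : u i = 0
    · simp [hu]
    · have hi := hz i
      calc _ ≤ u i ^ 2 / z i / 2 * (2 * z i) :=
            mul_le_mul_of_nonneg_left (h i hu) (by positivity)
        _ = u i ^ 2 := by field_simp
  linarith

lemma psd_of_noLoc {G : SimpleGraph V} (hloc : NoLoc G) (hdeg : ∀ i, (nb G i).card ≤ 9)
    (u : V → ℝ) : 0 ≤ QQ G u := by
  let uc : G.ConnectedComponent → V → ℝ := fun c i => if G.connectedComponentMk i = c then u i else 0
  have hsplit : QQ G u = ∑ c : G.ConnectedComponent, QQ G (uc c) := by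
    unfold QQ
    rw [Finset.sum_sub_distrib, ← Finset.mul_sum]
    congr 1
    · congr 1
      rw [Finset.sum_comm]
      refine Finset.sum_congr rfl fun i _ => ?_
      simp [uc, ite_pow]
    · conv_rhs => rw [Finset.sum_comm]
      refine Finset.sum_congr rfl fun i _ => ?_
      conv_rhs => rw [Finset.sum_comm]
      refine Finset.sum_congr rfl fun j _ => ?_
      by_cases hij : G.Adj i j
      · have : G.connectedComponentMk j = G.connectedComponentMk i :=
          SimpleGraph.ConnectedComponent.sound hij.symm.reachable
        simp only [uc, this]
        rw [Finset.sum_eq_single (G.connectedComponentMk i)]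
        · simp
        · intro c _ hc; simp [Ne.symm hc]
        · simp
      · simp [aa, hij]
  rw [hsplit]
  refine Finset.sum_nonneg fun c _ => ?_
  let N : Finset V := Finset.univ.filter fun i => G.connectedComponentMk i = c
  have hsupp : ∀ i, uc c i ≠ 0 → i ∈ N := by
    intro i hi
    by_contra h
    apply hi
    simp only [N, Finset.mem_filter, Finset.mem_univ, true_and] at h
    simp [uc, h]
  have hNcl : ∀ i ∈ N, ∀ j, G.Adj i j → j ∈ N := by
    intro i hi j hij
    simp only [N, Finset.mem_filter, Finset.mem_univ, true_and] at hi ⊢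
    rw [← hi]
    exact SimpleGraph.ConnectedComponent.sound hij.symm.reachable
  by_cases hN : N.card ≤ 91
  · exact hloc _ N (fun i hi => ⟨hsupp i hi, hNcl i (hsupp i hi)⟩) hN
  · refine QQ_of_z (zz G) (zz_pos G) _ fun i hi => zz_ok hloc hdeg ?_
    intro T hT hcl
    have : N ⊆ T := by
      intro j hj
      have hi' := hsupp i hi
      simp only [N, Finset.mem_filter, Finset.mem_univ, true_and] at hj hi'
      exact closed_reach (P := fun k => k ∈ T) (fun k l hk hkl => hcl k hk l hkl)
        (SimpleGraph.ConnectedComponent.exact (hi'.trans hj.symm)) hT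
    have := Finset.card_le_card this
    omega

lemma test_ineq {G : SimpleGraph V} (hP : ∀ v : V → ℝ, 0 ≤ 2 * QQ G v + (∑ i, v i) ^ 2)
    (X : Finset V) (hX : X.card = 49) (hind : ∀ x ∈ X, ∀ y ∈ X, ¬ G.Adj x y)
    (a : V → ℝ) (ha : ∀ x ∈ X, a x = 0) :
    0 ≤ 2 * QQ G a - ∑ x ∈ X, (∑ j, aa G x j * a j) ^ 2
      + 4 / 53 * (∑ i, a i + (∑ x ∈ X, ∑ j, aa G x j * a j) / 2) ^ 2 := by
  set nn : V → ℝ := fun x => ∑ j, aa G x j * a j with hnn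
  set W : ℝ := ∑ i, a i + (∑ x ∈ X, nn x) / 2 with hW
  set γ : ℝ := W / 53 with hγ
  let h : V → ℝ := fun x => if x ∈ X then nn x / 2 - γ else 0
  have hQh : QQ G h = 2 * ∑ x ∈ X, (nn x / 2 - γ) ^ 2 := by
    unfold QQ
    have h1 : ∑ i, ∑ j, aa G i j * (h i * h j) = 0 := by
      refine Finset.sum_eq_zero fun i _ => Finset.sum_eq_zero fun j _ => ?_
      by_cases hi : i ∈ X
      · by_cases hj : j ∈ X
        · simp [aa, hind i hi j hj]
        · simp [h, hj]
      · simp [h, hi]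
    have h2 : ∑ i, h i ^ 2 = ∑ x ∈ X, (nn x / 2 - γ) ^ 2 := by
      simp [h, ite_pow]
    rw [h1, h2]; ring
  have hC : CC G h a = - ∑ x ∈ X, (nn x / 2 - γ) * nn x := by
    unfold CC
    rw [← Finset.sum_neg_distrib]
    have : ∀ i, h i * (2 * a i - ∑ j, aa G i j * a j)
        = if i ∈ X then -((nn i / 2 - γ) * nn i) else 0 := by
      intro i
      by_cases hi : i ∈ X
      · simp [h, hi, ha i hi, hnn]
      · simp [h, hi]
    simp [this]
  have hsum : ∑ i, (1 * h i + 1 * a i) = W - 49 * γ := by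
    have : ∑ i, h i = (∑ x ∈ X, nn x) / 2 - 49 * γ := by
      simp only [h, Finset.sum_ite_mem, Finset.univ_inter, Finset.sum_sub_distrib,
        Finset.sum_const, hX, Finset.sum_div, nsmul_eq_mul]
      norm_num
    simp only [one_mul, Finset.sum_add_distrib, this, hW]
    ring
  have := hP (fun i => 1 * h i + 1 * a i)
  rw [QQ_add, hsum, hQh, hC] at this
  have e : 2 * (2 * ∑ x ∈ X, (nn x / 2 - γ) ^ 2) + 2 * (2 * -∑ x ∈ X, (nn x / 2 - γ) * nn x)
      = 49 * (4 * γ ^ 2) - ∑ x ∈ X, nn x ^ 2 := by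
    have : ∀ x, 4 * (nn x / 2 - γ) ^ 2 - 4 * ((nn x / 2 - γ) * nn x) = 4 * γ ^ 2 - nn x ^ 2 := by
      intro x; ring
    have h2 := Finset.sum_congr (rfl : X = X) fun x _ => this x
    rw [Finset.sum_sub_distrib, Finset.sum_sub_distrib, ← Finset.mul_sum, ← Finset.mul_sum,
      Finset.sum_const, hX] at h2
    simp only [nsmul_eq_mul] at h2
    push_cast at h2
    linarith
  have e2 : 49 * (4 * γ ^ 2) + (W - 49 * γ) ^ 2 = 4 / 53 * W ^ 2 := by
    rw [hγ]; ring
  linarith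

/-- indicator of a finset -/
noncomputable def ind (P : Finset V) (i : V) : ℝ := if i ∈ P then 1 else 0

lemma sum_ind (P : Finset V) : ∑ i, ind P i = P.card := by simp [ind]

lemma nn_ind (G : SimpleGraph V) (P : Finset V) (x : V) :
    ∑ j, aa G x j * ind P j = ((nb G x ∩ P).card : ℝ) := by
  rw [sum_aa]; simp [ind, Finset.sum_ite_mem]

lemma QQ_ind_le (G : SimpleGraph V) (P : Finset V) : QQ G (ind P) ≤ 2 * P.card := by
  unfold QQ
  have h1 : 0 ≤ ∑ i, ∑ j, aa G i j * (ind P i * ind P j) := by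
    refine Finset.sum_nonneg fun i _ => Finset.sum_nonneg fun j _ => ?_
    refine mul_nonneg (aa_nonneg _ _ _) (mul_nonneg ?_ ?_) <;> unfold ind <;> split_ifs <;> norm_num
  have h2 : ∑ i, ind P i ^ 2 = P.card := by simp [ind, ite_pow]
  rw [h2]; linarith

lemma dbl (G : SimpleGraph V) (X P : Finset V) :
    ∑ x ∈ X, ((nb G x ∩ P).card : ℝ) = ∑ y ∈ P, ((nb G y ∩ X).card : ℝ) := by
  have : ∀ x (Q : Finset V), ((nb G x ∩ Q).card : ℝ) = ∑ j ∈ Q, aa G x j := by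
    intro x Q
    rw [← nn_ind]
    simp [ind]
  simp only [this]
  rw [Finset.sum_comm]
  exact Finset.sum_congr rfl fun i _ => Finset.sum_congr rfl fun j _ => aa_symm _ _ _

lemma nat_sq_ge (k : ℕ) : (k : ℝ) ≤ (k : ℝ) ^ 2 := by
  have : k ≤ k ^ 2 := Nat.le_self_pow two_ne_zero k
  exact_mod_cast this

lemma dich {G : SimpleGraph V} (hP : ∀ v : V → ℝ, 0 ≤ 2 * QQ G v + (∑ i, v i) ^ 2)
    (X : Finset V) (hX : X.card = 49) (hind : ∀ x ∈ X, ∀ y ∈ X, ¬ G.Adj x y)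
    {y : V} (hy : y ∉ X) (h24 : (nb G y ∩ X).card ≤ 24) : (nb G y ∩ X).card ≤ 4 := by
  have h := test_ineq hP X hX hind (ind {y}) (by
    intro x hx; simp [ind]; rintro rfl; exact hy hx)
  simp only [nn_ind, sum_ind] at h
  rw [dbl] at h
  have h1 : ∑ x ∈ X, ((nb G x ∩ {y}).card : ℝ) ≤ ∑ x ∈ X, ((nb G x ∩ {y}).card : ℝ) ^ 2 :=
    Finset.sum_le_sum fun x _ => nat_sq_ge _
  rw [dbl] at h1
  have h2 := QQ_ind_le G {y}
  simp only [Finset.sum_singleton, Finset.card_singleton, Nat.cast_one] at h h1 h2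
  set b := (nb G y ∩ X).card
  by_contra hb
  have hb1 : (5 : ℝ) ≤ b := by exact_mod_cast (by omega : 5 ≤ b)
  have hb2 : (b : ℝ) ≤ 24 := by exact_mod_cast h24
  nlinarith [mul_nonneg (sub_nonneg.mpr hb1) (sub_nonneg.mpr hb2)]

lemma deg_X {G : SimpleGraph V} (hP : ∀ v : V → ℝ, 0 ≤ 2 * QQ G v + (∑ i, v i) ^ 2)
    (X : Finset V) (hX : X.card = 49) (hind : ∀ x ∈ X, ∀ y ∈ X, ¬ G.Adj x y)
    (hb : ∀ y, y ∉ X → (nb G y ∩ X).card ≤ 4) {x₀ : V} (hx₀ : x₀ ∈ X) : (nb G x₀).card ≤ 9 := by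
  by_contra hc
  obtain ⟨P, hPs, hPc⟩ := Finset.exists_subset_card_eq (show 10 ≤ (nb G x₀).card by omega)
  have hPX : ∀ y ∈ P, y ∉ X := fun y hy hyX => hind x₀ hx₀ y hyX (mem_nb.mp (hPs hy))
  have h := test_ineq hP X hX hind (ind P) (by
    intro x hx; simp [ind]; intro h; exact hPX x h hx)
  simp only [nn_ind, sum_ind] at h
  have hN0 : 0 ≤ ∑ x ∈ X, ((nb G x ∩ P).card : ℝ) := Finset.sum_nonneg fun _ _ => by positivity
  have hN1 : ∑ x ∈ X, ((nb G x ∩ P).card : ℝ) ≤ 40 := by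
    rw [dbl]
    have := Finset.sum_le_card_nsmul P (fun y => ((nb G y ∩ X).card : ℝ)) 4
      (fun y hy => by exact_mod_cast hb y (hPX y hy))
    rw [hPc] at this
    norm_num at this
    linarith
  have hsq : 90 + ∑ x ∈ X, ((nb G x ∩ P).card : ℝ) ≤ ∑ x ∈ X, ((nb G x ∩ P).card : ℝ) ^ 2 := by
    rw [← Finset.add_sum_erase X _ hx₀, ← Finset.add_sum_erase X _ hx₀]
    have h1 : ∑ x ∈ X.erase x₀, ((nb G x ∩ P).card : ℝ)
        ≤ ∑ x ∈ X.erase x₀, ((nb G x ∩ P).card : ℝ) ^ 2 :=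
      Finset.sum_le_sum fun x _ => nat_sq_ge _
    rw [Finset.inter_eq_right.mpr hPs, hPc]
    norm_num
    linarith
  have h2 := QQ_ind_le G P
  rw [hPc] at h h2
  push_cast at h h2
  set N := ∑ x ∈ X, ((nb G x ∩ P).card : ℝ)
  nlinarith [mul_nonneg hN0 (sub_nonneg.mpr hN1)]

lemma deg_Y {G : SimpleGraph V} (hP : ∀ v : V → ℝ, 0 ≤ 2 * QQ G v + (∑ i, v i) ^ 2)
    (X : Finset V) (hX : X.card = 49) (hind : ∀ x ∈ X, ∀ y ∈ X, ¬ G.Adj x y)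
    (hb : ∀ y, y ∉ X → (nb G y ∩ X).card ≤ 4) {y₀ : V} (hy₀ : y₀ ∉ X) : (nb G y₀).card ≤ 9 := by
  by_contra hc
  have hsplit := Finset.card_inter_add_card_sdiff (nb G y₀) X
  have hs4 := hb y₀ hy₀
  obtain ⟨P, hPs, hPc⟩ := Finset.exists_subset_card_eq (show 6 ≤ (nb G y₀ \ X).card by omega)
  have hPX : ∀ y ∈ P, y ∉ X := fun y hy => (Finset.mem_sdiff.mp (hPs hy)).2
  have hPn : P ⊆ nb G y₀ := fun y hy => (Finset.mem_sdiff.mp (hPs hy)).1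
  have hyP : y₀ ∉ P := fun h => G.loopless.irrefl _ (mem_nb.mp (hPn h))
  have h := test_ineq hP X hX hind (fun i => 3 * (Pi.single y₀ 1 : V → ℝ) i + 1 * ind P i) (by
    intro x hx
    have h1 : x ≠ y₀ := by rintro rfl; exact hy₀ hx
    have h2 : x ∉ P := fun h => hPX x h hx
    simp [ind, h1, h2])
  have hnn : ∀ x, ∑ j, aa G x j * (3 * (Pi.single y₀ 1 : V → ℝ) j + 1 * ind P j)
      = 3 * ((nb G x ∩ {y₀}).card : ℝ) + ((nb G x ∩ P).card : ℝ) := by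
    intro x
    rw [← nn_ind, ← nn_ind, Finset.mul_sum, ← Finset.sum_add_distrib]
    refine Finset.sum_congr rfl fun j _ => ?_
    have : (Pi.single y₀ 1 : V → ℝ) j = ind {y₀} j := by
      simp [ind, Pi.single_apply]
    rw [this]; ring
  have hsum : ∑ i, (3 * (Pi.single y₀ 1 : V → ℝ) i + 1 * ind P i) = 9 := by
    rw [Finset.sum_add_distrib, ← Finset.mul_sum, ← Finset.mul_sum, sum_ind, hPc]
    simp; norm_num
  have hCC : CC G (Pi.single y₀ 1) (ind P) = -6 := by
    rw [CC_single, nn_ind, Finset.inter_eq_right.mpr hPn, hPc]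
    simp [ind, hyP]
  have h2 := QQ_ind_le G P
  simp only [hnn] at h
  rw [hsum, QQ_add, QQ_single, hCC] at h
  rw [Finset.sum_add_distrib, ← Finset.mul_sum] at h
  have hs : ∑ x ∈ X, ((nb G x ∩ {y₀}).card : ℝ) = ((nb G y₀ ∩ X).card : ℝ) := by
    rw [dbl]; simp
  have hN0 : 0 ≤ ∑ x ∈ X, ((nb G x ∩ P).card : ℝ) := Finset.sum_nonneg fun _ _ => by positivity
  have hN1 : ∑ x ∈ X, ((nb G x ∩ P).card : ℝ) ≤ 24 := by
    rw [dbl]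
    have := Finset.sum_le_card_nsmul P (fun y => ((nb G y ∩ X).card : ℝ)) 4
      (fun y hy => by exact_mod_cast hb y (hPX y hy))
    rw [hPc] at this
    norm_num at this
    linarith
  have hsq : 9 * ∑ x ∈ X, ((nb G x ∩ {y₀}).card : ℝ) + ∑ x ∈ X, ((nb G x ∩ P).card : ℝ)
      ≤ ∑ x ∈ X, (3 * ((nb G x ∩ {y₀}).card : ℝ) + ((nb G x ∩ P).card : ℝ)) ^ 2 := by
    rw [Finset.mul_sum, ← Finset.sum_add_distrib]
    refine Finset.sum_le_sum fun x _ => ?_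
    have e1 := nat_sq_ge (nb G x ∩ {y₀}).card
    have e2 := nat_sq_ge (nb G x ∩ P).card
    have e3 : (0 : ℝ) ≤ ((nb G x ∩ {y₀}).card : ℝ) * ((nb G x ∩ P).card : ℝ) := by positivity
    nlinarith
  rw [hs] at h hsq
  rw [hPc] at h2
  push_cast at h2
  set N := ∑ x ∈ X, ((nb G x ∩ P).card : ℝ)
  have hNN := mul_nonneg hN0 (sub_nonneg.mpr hN1)
  generalize (nb G y₀ ∩ X).card = s at *
  interval_cases s <;> norm_num at h hsq <;> nlinarith

lemma core_ker {G : SimpleGraph V} (hP : ∀ v : V → ℝ, 0 ≤ 2 * QQ G v + (∑ i, v i) ^ 2)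
    (X : Finset V) (hX : X.card = 49) (hind : ∀ x ∈ X, ∀ y ∈ X, ¬ G.Adj x y)
    (hb : ∀ y, y ∉ X → (nb G y ∩ X).card ≤ 24) (hn : 277 ≤ Fintype.card V) :
    3 * Module.finrank ℝ (LinearMap.ker (MM G).mulVecLin) + 3 ≤ Fintype.card V := by
  have hb4 : ∀ y, y ∉ X → (nb G y ∩ X).card ≤ 4 := fun y hy => dich hP X hX hind hy (hb y hy)
  have hdeg : ∀ i, (nb G i).card ≤ 9 := by
    intro i
    by_cases hi : i ∈ X
    · exact deg_X hP X hX hind hb4 hi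
    · exact deg_Y hP X hX hind hb4 hi
  by_cases hloc : NoLoc G
  · exact ker_bound_psd (psd_of_noLoc hloc hdeg) (by omega)
  · unfold NoLoc at hloc
    push Not at hloc
    obtain ⟨u, N, hN, hNc, hu⟩ := hloc
    have := ker_bound_loc hP u hu N hN
    omega

lemma core_rank {G : SimpleGraph V} (hP : ∀ v : V → ℝ, 0 ≤ v ⬝ᵥ (MM G *ᵥ v))
    (X : Finset V) (hX : X.card = 49) (hind : ∀ x ∈ X, ∀ y ∈ X, ¬ G.Adj x y)
    (hb : ∀ y, y ∉ X → (nb G y ∩ X).card ≤ 24) (hn : 277 ≤ Fintype.card V) :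
    2 * (Fintype.card V : ℝ) / 3 + 1 ≤ ((MM G).rank : ℝ) := by
  have h1 := core_ker (fun v => MM_form G v ▸ hP v) X hX hind hb hn
  have h2 := rank_ker (MM G)
  have h3 : 2 * Fintype.card V + 3 ≤ 3 * (MM G).rank := by omega
  have h4 : 2 * (Fintype.card V : ℝ) + 3 ≤ 3 * ((MM G).rank : ℝ) := by exact_mod_cast h3
  linarith

end core

lemma psd_of_minEig {n : ℕ} (S : Matrix (Fin n) (Fin n) ℝ) (hS : IsSeidel S)
    (hmin : minEig S = -5) (v : Fin n → ℝ) : 0 ≤ v ⬝ᵥ ((S + (5 : ℝ) • 1) *ᵥ v) := by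
  have hA : S.IsHermitian := by
    rw [Matrix.IsHermitian, Matrix.conjTranspose_eq_transpose_of_trivial]; exact hS.1
  unfold minEig at hmin
  rw [dif_pos hA] at hmin
  have hev : ∀ i, -5 ≤ hA.eigenvalues i := by
    intro i
    rw [← hmin]
    exact ciInf_le (Set.finite_range _).bddBelow i
  have hp : (S + (5 : ℝ) • (1 : Matrix (Fin n) (Fin n) ℝ)).PosSemidef := by
    have hU : (hA.eigenvectorUnitary : Matrix (Fin n) (Fin n) ℝ) *
        star (hA.eigenvectorUnitary : Matrix (Fin n) (Fin n) ℝ) = 1 :=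
      Unitary.mul_star_self_of_mem hA.eigenvectorUnitary.2
    have h1 : S + (5 : ℝ) • 1 = (hA.eigenvectorUnitary : Matrix (Fin n) (Fin n) ℝ) *
        Matrix.diagonal (fun i => hA.eigenvalues i + 5) *
        star (hA.eigenvectorUnitary : Matrix (Fin n) (Fin n) ℝ) := by
      have h2 := hA.spectral_theorem
      rw [Unitary.conjStarAlgAut_apply] at h2
      have h3 : Matrix.diagonal (fun i => hA.eigenvalues i + 5)
          = Matrix.diagonal (RCLike.ofReal ∘ hA.eigenvalues) + (5 : ℝ) • 1 := by
        ext i j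
        by_cases hij : i = j
        · subst hij; simp
        · simp [hij]
      rw [h3, mul_add, add_mul, ← h2]
      simp [hU]
    rw [h1]
    have h4 : (Matrix.diagonal (fun i => hA.eigenvalues i + 5)).PosSemidef :=
      Matrix.PosSemidef.diagonal (fun i => by
        show (0 : ℝ) ≤ hA.eigenvalues i + 5
        linarith [hev i])
    exact h4.mul_mul_conjTranspose_same _
  simpa using hp.dotProduct_mulVec_nonneg v

open scoped Classical in
lemma indep_data {n : ℕ} (S : Matrix (Fin n) (Fin n) ℝ) (hS : IsSeidel S)
    (hα : 49 ≤ indepNum (switchGraph S)) :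
    ∃ (X : Finset (Fin n)) (ε : Fin n → ℝ), X.card = 49 ∧ (∀ i, ε i = 1 ∨ ε i = -1) ∧
      ∀ i ∈ X, ∀ j ∈ X, i ≠ j → ε i * ε j * S i j = 1 := by
  obtain ⟨s, hs⟩ := (switchGraph S)ᶜ.exists_isNClique_cliqueNum
  have hcard : 49 ≤ s.card := by rw [hs.card_eq]; exact hα
  have hpair : ∀ x ∈ s, ∀ y ∈ s, x ≠ y →
      Matrix.fromBlocks S (1 - S) (1 - S) S x y ≠ -1 := by
    intro x hx y hy hxy h
    have := hs.isClique hx hy hxy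
    rw [SimpleGraph.compl_adj] at this
    exact this.2 (by
      unfold switchGraph
      rw [SimpleGraph.fromRel_adj]
      exact ⟨hxy, Or.inl h⟩)
  have hval : ∀ i j, i ≠ j → S i j = 1 ∨ S i j = -1 := hS.2.2
  have hboth : ∀ i, ¬ (Sum.inl i ∈ s ∧ Sum.inr i ∈ s) := by
    rintro i ⟨h1, h2⟩
    have : ∃ z ∈ s, z ∉ ({Sum.inl i, Sum.inr i} : Finset (Fin n ⊕ Fin n)) := by
      by_contra hno
      push Not at hno
      have h3 := Finset.card_le_card (show s ⊆ _ from hno)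
      have h4 := Finset.card_le_two (a := (Sum.inl i : Fin n ⊕ Fin n)) (b := Sum.inr i)
      omega
    obtain ⟨z, hz, hzn⟩ := this
    simp only [Finset.mem_insert, Finset.mem_singleton, not_or] at hzn
    have e1 := hpair _ h1 z hz (Ne.symm hzn.1)
    have e2 := hpair _ h2 z hz (Ne.symm hzn.2)
    rcases z with j | j
    · have hij : i ≠ j := fun h => hzn.1 (by rw [h])
      simp only [Matrix.fromBlocks_apply₁₁, Matrix.fromBlocks_apply₂₁, Matrix.sub_apply,
        Matrix.one_apply_ne hij] at e1 e2
      rcases hval i j hij with h | h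
      · exact e2 (by rw [h]; norm_num)
      · exact e1 h
    · have hij : i ≠ j := fun h => hzn.2 (by rw [h])
      simp only [Matrix.fromBlocks_apply₁₂, Matrix.fromBlocks_apply₂₂, Matrix.sub_apply,
        Matrix.one_apply_ne hij] at e1 e2
      rcases hval i j hij with h | h
      · exact e1 (by rw [h]; norm_num)
      · exact e2 h
  have hinj : Set.InjOn (Sum.elim id id : Fin n ⊕ Fin n → Fin n) s := by
    rintro (i | i) hx (j | j) hy h
    · simp only [Sum.elim_inl, id] at h; rw [h]
    · simp only [Sum.elim_inl, Sum.elim_inr, id] at h; subst h; exact absurd ⟨hx, hy⟩ (hboth i)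
    · simp only [Sum.elim_inl, Sum.elim_inr, id] at h; subst h; exact absurd ⟨hy, hx⟩ (hboth i)
    · simp only [Sum.elim_inr, id] at h; rw [h]
  have hc2 : 49 ≤ (s.image (Sum.elim id id : Fin n ⊕ Fin n → Fin n)).card := by
    rw [Finset.card_image_of_injOn hinj]; exact hcard
  obtain ⟨X, hXs, hXc⟩ := Finset.exists_subset_card_eq hc2
  refine ⟨X, fun i => if Sum.inr i ∈ s then -1 else 1, hXc, ?_, ?_⟩
  · intro i; dsimp only; split_ifs <;> simp
  · intro i hi j hj hij
    have key : ∀ k ∈ X, (Sum.inl k ∈ s ∧ Sum.inr k ∉ s) ∨ Sum.inr k ∈ s := by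
      intro k hk
      obtain ⟨x, hx, hxk⟩ := Finset.mem_image.mp (hXs hk)
      rcases x with l | l
      · simp only [Sum.elim_inl, id] at hxk
        subst hxk
        exact Or.inl ⟨hx, fun h => hboth l ⟨hx, h⟩⟩
      · simp only [Sum.elim_inr, id] at hxk
        subst hxk
        exact Or.inr hx
    rcases key i hi with ⟨h1, h1'⟩ | h1 <;> rcases key j hj with ⟨h2, h2'⟩ | h2
    · have e := hpair _ h1 _ h2 (by simpa using hij)
      simp only [Matrix.fromBlocks_apply₁₁] at e
      rcases hval i j hij with h | h
      · simp [h1', h2', h]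
      · exact absurd h e
    · have e := hpair _ h1 _ h2 (by simp)
      simp only [Matrix.fromBlocks_apply₁₂, Matrix.sub_apply, Matrix.one_apply_ne hij] at e
      rcases hval i j hij with h | h
      · rw [h] at e; norm_num at e
      · simp [h1', h2, h]
    · have e := hpair _ h1 _ h2 (by simp)
      simp only [Matrix.fromBlocks_apply₂₁, Matrix.sub_apply, Matrix.one_apply_ne hij] at e
      rcases hval i j hij with h | h
      · rw [h] at e; norm_num at e
      · simp [h1, h2', h]
    · have e := hpair _ h1 _ h2 (by simpa using hij)
      simp only [Matrix.fromBlocks_apply₂₂] at e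
      rcases hval i j hij with h | h
      · simp [h1, h2, h]
      · exact absurd h e

open scoped Classical in
lemma switch_data {n : ℕ} (S : Matrix (Fin n) (Fin n) ℝ) (hS : IsSeidel S)
    (hα : 49 ≤ indepNum (switchGraph S)) :
    ∃ (X : Finset (Fin n)) (ε : Fin n → ℝ), X.card = 49 ∧ (∀ i, ε i = 1 ∨ ε i = -1) ∧
      (∀ i ∈ X, ∀ j ∈ X, i ≠ j → ε i * ε j * S i j = 1) ∧
      ∀ y, y ∉ X → (X.filter fun x => ε y * ε x * S y x = -1).card ≤ 24 := by
  obtain ⟨X, ε, hX, hε, hXX⟩ := indep_data S hS hα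
  let ε' : Fin n → ℝ := fun y => if y ∈ X then ε y else
    if (X.filter fun x => ε x * S y x = -1).card ≤ 24 then 1 else -1
  have hin : ∀ y ∈ X, ε' y = ε y := fun y hy => by simp [ε', hy]
  refine ⟨X, ε', hX, ?_, ?_, ?_⟩
  · intro i
    simp only [ε']
    split_ifs
    · exact hε i
    · simp
    · simp
  · intro i hi j hj hij
    rw [hin i hi, hin j hj]; exact hXX i hi j hj hij
  · intro y hy
    by_cases hc : (X.filter fun x => ε x * S y x = -1).card ≤ 24
    · have : ε' y = 1 := by simp only [ε', if_neg hy, if_pos hc]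
      rw [this]
      convert hc using 2
      refine Finset.filter_congr fun x hx => ?_
      rw [hin x hx, one_mul]
    · have : ε' y = -1 := by simp only [ε', if_neg hy, if_neg hc]
      rw [this]
      have h1 := Finset.card_filter_add_card_filter_not (s := X) (fun x => ε x * S y x = -1)
      have h2 : (X.filter fun x => -1 * ε' x * S y x = -1)
          ⊆ X.filter fun x => ¬ (ε x * S y x = -1) := by
        intro x hx
        obtain ⟨hxX, hx2⟩ := Finset.mem_filter.mp hx
        rw [hin x hxX] at hx2
        refine Finset.mem_filter.mpr ⟨hxX, fun h => ?_⟩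
        rw [mul_assoc, h] at hx2
        norm_num at hx2
      have h3 := Finset.card_le_card h2
      omega

/-- If `S` is a Seidel matrix of order `n ≥ 277` with smallest eigenvalue
exactly `-5` and `α([S]) ≥ 49`, then `rk(S + 5I) ≥ 2n/3 + 1`. -/
theorem stmt_4 {n : ℕ} (S : Matrix (Fin n) (Fin n) ℝ) (hS : IsSeidel S)
    (hmin : minEig S = -5) (hn : 277 ≤ n)
    (hα : 49 ≤ indepNum (switchGraph S)) :
    2 * (n : ℝ) / 3 + 1 ≤ ((S + (5 : ℝ) • 1).rank : ℝ) := by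
  classical
  obtain ⟨X, ε, hX, hε, hXX, hXY⟩ := switch_data S hS hα
  have hsq : ∀ i, ε i * ε i = 1 := fun i => by rcases hε i with h | h <;> rw [h] <;> norm_num
  have hsym : ∀ i j, S i j = S j i := fun i j => hS.1.apply j i
  let G : SimpleGraph (Fin n) :=
    { Adj := fun i j => i ≠ j ∧ ε i * ε j * S i j = -1
      symm := ⟨fun i j h => ⟨h.1.symm, by rw [hsym j i, mul_comm (ε j)]; exact h.2⟩⟩
      loopless := ⟨fun i h => h.1 rfl⟩ }
  have hMM : MM G = Matrix.diagonal ε * (S + (5 : ℝ) • 1) * Matrix.diagonal ε := by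
    ext i j
    rw [Matrix.mul_diagonal, Matrix.diagonal_mul]
    simp only [MM, Matrix.of_apply, Matrix.add_apply, Matrix.smul_apply, smul_eq_mul, aa]
    by_cases hij : i = j
    · subst hij
      have h0 : ¬ G.Adj i i := G.loopless.irrefl i
      simp only [h0, if_false, if_true, Matrix.one_apply_eq, hS.2.1 i]
      nlinarith [hsq i]
    · rw [Matrix.one_apply_ne hij]
      have hpm : ε i * ε j * S i j = 1 ∨ ε i * ε j * S i j = -1 := by
        rcases hε i with h1 | h1 <;> rcases hε j with h2 | h2 <;>
          rcases hS.2.2 i j hij with h3 | h3 <;> rw [h1, h2, h3] <;> norm_num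
      have e : ε i * (S i j + 5 * 0) * ε j = ε i * ε j * S i j := by ring
      rw [e]
      rcases hpm with h | h
      · have h0 : ¬ G.Adj i j := fun h' => by
          have := h'.2
          rw [h] at this; norm_num at this
        rw [h]; simp [hij, h0]
      · have h0 : G.Adj i j := ⟨hij, h⟩
        rw [h]; simp [hij, h0]; norm_num
  have hdet : IsUnit (Matrix.diagonal ε).det := by
    rw [Matrix.det_diagonal, isUnit_iff_ne_zero, Finset.prod_ne_zero_iff]
    intro i _
    rcases hε i with h | h <;> rw [h] <;> norm_num
  have hrank : (MM G).rank = (S + (5 : ℝ) • 1).rank := by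
    rw [hMM, Matrix.rank_mul_eq_left_of_isUnit_det _ _ hdet,
      Matrix.rank_mul_eq_right_of_isUnit_det _ _ hdet]
  have hP : ∀ v : Fin n → ℝ, 0 ≤ v ⬝ᵥ (MM G *ᵥ v) := by
    intro v
    have h := psd_of_minEig S hS hmin (Matrix.diagonal ε *ᵥ v)
    have e : v ⬝ᵥ (MM G *ᵥ v) = (Matrix.diagonal ε *ᵥ v) ⬝ᵥ
        ((S + (5 : ℝ) • 1) *ᵥ (Matrix.diagonal ε *ᵥ v)) := by
      rw [hMM, ← Matrix.mulVec_mulVec, ← Matrix.mulVec_mulVec, Matrix.dotProduct_mulVec,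
        ← Matrix.mulVec_transpose, Matrix.diagonal_transpose]
    rw [e]; exact h
  have hfin := core_rank hP X hX (by
    intro x hx y hy hxy
    have h1 := hXX x hx y hy hxy.1
    have h2 := hxy.2
    rw [h1] at h2; norm_num at h2) (by
    intro y hy
    refine le_trans (Finset.card_le_card ?_) (hXY y hy)
    intro x hx
    obtain ⟨hx1, hx2⟩ :=
      (@Finset.mem_inter _ (fun a b => Classical.propDecidable (a = b)) _ _ _).mp hx
    exact Finset.mem_filter.mpr ⟨hx2, (mem_nb.mp hx1).2⟩) (by simpa using hn)
  rw [hrank] at hfin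
  simpa using hfin
end

section
/- Let S be a Seidel matrix of order n ≥ 277 with smallest eigenvalue exactly −5. If there exists a triangle-free simple graph G on n vertices and a diagonal ±1 matrix D with S(G) = D S D (i.e., the switching class of S contains a triangle-free graph), then rk(S + 5I) ≥ 2n/3 + 1. -/
open Matrix

/-! ### Bilinear form of the adjacency matrix -/
namespace TF
open Finset
open scoped Classical
set_option linter.unusedSectionVars false

variable {V : Type*} [Fintype V]

/-- The adjacency bilinear form. -/
noncomputable def E (G : SimpleGraph V) (x y : V → ℝ) : ℝ :=
  ∑ u, ∑ v, if G.Adj u v then x u * y v else 0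

/-- The quadratic form of `2 I - A`. -/
noncomputable def Q (G : SimpleGraph V) (x : V → ℝ) : ℝ := 2 * ∑ v, x v ^ 2 - E G x x

/-- Indicator vector. -/
noncomputable def ind (A : Finset V) : V → ℝ := fun v => if v ∈ A then 1 else 0

/-- Restriction of a vector to a set. -/
noncomputable def res (A : Finset V) (x : V → ℝ) : V → ℝ := fun v => if v ∈ A then x v else 0

lemma E_add_left (G : SimpleGraph V) (x y z : V → ℝ) : E G (x + y) z = E G x z + E G y z := by
  simp only [E, ← Finset.sum_add_distrib]
  refine Finset.sum_congr rfl fun u _ => Finset.sum_congr rfl fun v _ => ?_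
  split_ifs <;> simp [add_mul]

lemma E_comm (G : SimpleGraph V) (x y : V → ℝ) : E G x y = E G y x := by
  unfold E
  rw [Finset.sum_comm]
  refine Finset.sum_congr rfl fun u _ => Finset.sum_congr rfl fun v _ => ?_
  simp only [G.adj_comm, mul_comm]

lemma E_add_right (G : SimpleGraph V) (x y z : V → ℝ) : E G z (x + y) = E G z x + E G z y := by
  rw [E_comm, E_add_left, E_comm G x, E_comm G y]

lemma E_smul_left (G : SimpleGraph V) (c : ℝ) (x y : V → ℝ) : E G (c • x) y = c * E G x y := by
  simp only [E, Finset.mul_sum]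
  refine Finset.sum_congr rfl fun u _ => Finset.sum_congr rfl fun v _ => ?_
  split_ifs <;> simp [mul_assoc]

lemma E_smul_right (G : SimpleGraph V) (c : ℝ) (x y : V → ℝ) : E G x (c • y) = c * E G x y := by
  rw [E_comm, E_smul_left, E_comm]

lemma E_ind (G : SimpleGraph V) (A B : Finset V) :
    E G (ind A) (ind B) = ∑ u ∈ A, ((B.filter (G.Adj u)).card : ℝ) := by
  simp only [E, ind]
  rw [← Finset.sum_filter_add_sum_filter_not univ (· ∈ A)]
  rw [Finset.sum_eq_zero (s := univ.filter (¬ · ∈ A))]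
  · rw [add_zero, Finset.filter_mem_eq_inter, Finset.univ_inter]
    refine Finset.sum_congr rfl fun u hu => ?_
    rw [Finset.card_filter, Nat.cast_sum, ← Finset.sum_subset (Finset.subset_univ B)]
    · refine Finset.sum_congr rfl fun v hv => ?_
      simp [hu, hv]
    · intro v _ hv; simp [hv]
  · intro u hu
    simp at hu
    simp [hu]

lemma E_nonneg (G : SimpleGraph V) (x y : V → ℝ) (hx : ∀ v, 0 ≤ x v) (hy : ∀ v, 0 ≤ y v) :
    0 ≤ E G x y := by
  refine Finset.sum_nonneg fun u _ => Finset.sum_nonneg fun v _ => ?_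
  split_ifs
  · exact mul_nonneg (hx _) (hy _)
  · exact le_rfl

lemma ind_nonneg (A : Finset V) (v : V) : 0 ≤ ind A v := by
  unfold ind; split_ifs <;> norm_num

lemma E_ind_nonneg (G : SimpleGraph V) (A B : Finset V) : 0 ≤ E G (ind A) (ind B) :=
  E_nonneg G _ _ (ind_nonneg A) (ind_nonneg B)

lemma E_zero_of (G : SimpleGraph V) (x y : V → ℝ)
    (h : ∀ u v, G.Adj u v → x u ≠ 0 → y v ≠ 0 → False) : E G x y = 0 := by
  refine Finset.sum_eq_zero fun u _ => Finset.sum_eq_zero fun v _ => ?_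
  split_ifs with ha
  · by_contra hne
    exact h u v ha (left_ne_zero_of_mul hne) (right_ne_zero_of_mul hne)
  · rfl

lemma mem_of_ind {A : Finset V} {v : V} (h : ind A v ≠ 0) : v ∈ A := by
  by_contra hv; simp [ind, hv] at h

lemma mem_of_res {A : Finset V} {x : V → ℝ} {v : V} (h : res A x v ≠ 0) : v ∈ A := by
  by_contra hv; simp [res, hv] at h

lemma E_ind_zero (G : SimpleGraph V) (A B : Finset V)
    (h : ∀ u ∈ A, ∀ v ∈ B, ¬ G.Adj u v) : E G (ind A) (ind B) = 0 :=
  E_zero_of G _ _ fun u v ha hu hv => h u (mem_of_ind hu) v (mem_of_ind hv) ha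

lemma sum_ind (A : Finset V) : ∑ v, ind A v = A.card := by
  simp [ind]

lemma sum_ind_mul (A B : Finset V) (h : Disjoint A B) : ∑ v, ind A v * ind B v = 0 := by
  refine Finset.sum_eq_zero fun v _ => ?_
  by_contra hne
  exact Finset.disjoint_left.mp h (mem_of_ind (left_ne_zero_of_mul hne))
    (mem_of_ind (right_ne_zero_of_mul hne))

lemma sum_ind_sq (A : Finset V) : ∑ v, ind A v * ind A v = A.card := by
  simp [ind]

lemma Q_add (G : SimpleGraph V) (x y : V → ℝ) :
    Q G (x + y) = Q G x + Q G y + 4 * ∑ v, x v * y v - 2 * E G x y := by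
  have : ∑ v, (x + y) v ^ 2 = ∑ v, x v ^ 2 + ∑ v, y v ^ 2 + 2 * ∑ v, x v * y v := by
    rw [Finset.mul_sum, ← Finset.sum_add_distrib, ← Finset.sum_add_distrib]
    refine Finset.sum_congr rfl fun v _ => ?_
    simp only [Pi.add_apply]; ring
  unfold Q
  rw [this, E_add_left, E_add_right, E_add_right, E_comm G y x]
  ring

lemma Q_smul (G : SimpleGraph V) (c : ℝ) (x : V → ℝ) : Q G (c • x) = c ^ 2 * Q G x := by
  unfold Q
  rw [E_smul_left, E_smul_right]
  simp only [Pi.smul_apply, smul_eq_mul, mul_pow, ← Finset.mul_sum]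
  ring

lemma Q_abs (G : SimpleGraph V) (x : V → ℝ) : Q G (fun v => |x v|) ≤ Q G x := by
  unfold Q E
  simp only [sq_abs]
  refine sub_le_sub_left (Finset.sum_le_sum fun u _ => Finset.sum_le_sum fun v _ => ?_) _
  split_ifs
  · rw [← abs_mul]; exact le_abs_self _
  · exact le_rfl

/-- If there is no edge between, and disjoint supports, then `Q` splits. -/
lemma Q_split (G : SimpleGraph V) (x y : V → ℝ) (hd : ∀ v, x v ≠ 0 → y v ≠ 0 → False)
    (h : ∀ u v, G.Adj u v → x u ≠ 0 → y v ≠ 0 → False) : Q G (x + y) = Q G x + Q G y := by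
  rw [Q_add, E_zero_of G x y h, Finset.sum_eq_zero]
  · ring
  · intro v _
    by_contra hne
    exact hd v (left_ne_zero_of_mul hne) (right_ne_zero_of_mul hne)

lemma Q_ind (G : SimpleGraph V) (A : Finset V) :
    Q G (ind A) = 2 * A.card - E G (ind A) (ind A) := by
  unfold Q
  have : ∑ v, ind A v ^ 2 = A.card := by rw [← sum_ind_sq]; simp [sq]
  rw [this]

/-- Kernel lemma: a minimum of `Q` restricted to vectors supported on `P`. -/
lemma kernel_of_min (G : SimpleGraph V) (P : Finset V)
    (hP : ∀ x : V → ℝ, (∀ v, v ∉ P → x v = 0) → 0 ≤ Q G x)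
    (h : V → ℝ) (hs : ∀ v, v ∉ P → h v = 0) (h0 : Q G h ≤ 0) (u : V) (hu : u ∈ P) :
    2 * h u = ∑ v, if G.Adj u v then h v else 0 := by
  set s := ∑ v, (if G.Adj u v then h v else 0) with hsdef
  have key : ∀ t : ℝ, 0 ≤ Q G h + t ^ 2 * 2 + 4 * (t * h u) - 2 * (t * s) := by
    intro t
    have h1 := hP (h + t • ind {u}) (by
      intro v hv
      have : v ≠ u := fun e => hv (e ▸ hu)
      simp [ind, this, hs v hv])
    have e1 : ∑ v, h v * (t • ind {u}) v = t * h u := by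
      simp [ind, mul_comm]
    have e2 : E G (ind {u}) h = s := by
      unfold E
      rw [Finset.sum_eq_single u]
      · simp [ind, hsdef]
      · intro b _ hb; simp [ind, hb]
      · simp
    rw [Q_add, Q_smul, e1, E_smul_right, E_comm, e2, Q_ind, E_ind_zero] at h1
    · simpa using h1
    · intro a ha b hb
      simp at ha hb
      simp [ha, hb]
  have hz : Q G h = 0 := le_antisymm h0 (hP h hs)
  have k1 := key ((s - 2 * h u) / 2)
  rw [hz] at k1
  nlinarith [sq_nonneg (s - 2 * h u)]
end TF

/-! ### Test vectors -/
namespace TF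
open Finset
open scoped Classical
set_option linter.unusedSectionVars false

variable {V : Type*} [Fintype V]

/-- Positive semidefiniteness of `J + 4 I - 2 A`. -/
def PSD (G : SimpleGraph V) : Prop := ∀ y : V → ℝ, 0 ≤ (∑ v, y v) ^ 2 + 2 * Q G y

/-- Expansion of the form on a combination of three indicators. -/
lemma Q_three (G : SimpleGraph V) (A B C : Finset V) (hAB : Disjoint A B) (hAC : Disjoint A C)
    (hBC : Disjoint B C) (a b c : ℝ) :
    Q G (a • ind A + b • ind B + c • ind C) =
      2 * (a ^ 2 * A.card + b ^ 2 * B.card + c ^ 2 * C.card)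
      - (a ^ 2 * E G (ind A) (ind A) + b ^ 2 * E G (ind B) (ind B) + c ^ 2 * E G (ind C) (ind C)
        + 2 * a * b * E G (ind A) (ind B) + 2 * a * c * E G (ind A) (ind C)
        + 2 * b * c * E G (ind B) (ind C)) := by
  have d : ∀ (s t : ℝ) (X Y : Finset V), Disjoint X Y → ∑ v, (s • ind X) v * (t • ind Y) v = 0 := by
    intro s t X Y h
    have : ∀ v, (s • ind X) v * (t • ind Y) v = (s * t) * (ind X v * ind Y v) := by
      intro v; simp only [Pi.smul_apply, smul_eq_mul]; ring
    simp only [this, ← Finset.mul_sum, sum_ind_mul X Y h, mul_zero]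
  rw [Q_add, Q_add, Q_smul, Q_smul, Q_smul, Q_ind, Q_ind, Q_ind, E_add_left]
  simp only [E_smul_left, E_smul_right, d a b A B hAB]
  have : ∑ v, (a • ind A + b • ind B) v * (c • ind C) v = 0 := by
    simp only [Pi.add_apply, add_mul, Finset.sum_add_distrib, d a c A C hAC, d b c B C hBC, add_zero]
  rw [this]
  ring

lemma sum_three (A B C : Finset V) (a b c : ℝ) :
    ∑ v, (a • ind A + b • ind B + c • ind C) v = a * A.card + b * B.card + c * C.card := by
  simp only [Pi.add_apply, Pi.smul_apply, smul_eq_mul, Finset.sum_add_distrib, ← Finset.mul_sum,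
    sum_ind]

lemma E_single (G : SimpleGraph V) (v : V) (B : Finset V) :
    E G (ind {v}) (ind B) = ((B.filter (G.Adj v)).card : ℝ) := by
  rw [E_ind]; simp

/-- Star test: the star at `v` against a set `X` away from it. -/
lemma star_test (G : SimpleGraph V) (h : PSD G) (v : V) (N X : Finset V)
    (hN : N = univ.filter (G.Adj v)) (hX : ∀ x ∈ X, x ≠ v ∧ ¬ G.Adj v x) (L : ℝ)
    (hL : E G (ind N) (ind X) ≤ L) (hk : 0 < N.card) :
    (X.card : ℝ) * (N.card - 4) ≤ 9 * N.card + 6 * L := by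
  have hkr : (0 : ℝ) < N.card := by exact_mod_cast hk
  have hL0 : 0 ≤ L := le_trans (E_ind_nonneg _ _ _) hL
  rcases Nat.eq_zero_or_pos X.card with h0 | h0
  · rw [h0]; push_cast; nlinarith
  have hcr : (0 : ℝ) < X.card := by exact_mod_cast h0
  have hd1 : Disjoint {v} N := by simp [hN]
  have hd2 : Disjoint {v} X := by
    simp only [Finset.disjoint_singleton_left]
    exact fun hv => (hX v hv).1 rfl
  have hd3 : Disjoint N X := by
    rw [Finset.disjoint_left]
    intro x hx hx'
    rw [hN] at hx
    exact (hX x hx').2 (by simpa using hx)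
  set k : ℝ := ((N.card : ℕ) : ℝ) with hkdef
  set c : ℝ := ((X.card : ℕ) : ℝ) with hcdef
  have := h ((k * c) • ind {v} + (2 * c) • ind N + (-(3 * k)) • ind X)
  rw [sum_three, Q_three G _ _ _ hd1 hd2 hd3] at this
  have e1 : E G (ind {v}) (ind N) = k := by
    rw [E_single, hkdef, hN, Finset.filter_filter]; simp
  have e2 : E G (ind {v}) (ind X) = 0 :=
    E_ind_zero G _ _ (by simpa using fun x hx => (hX x hx).2)
  have e3 : E G (ind {v}) (ind {v}) = 0 := E_ind_zero G _ _ (by simp)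
  have e4 := E_ind_nonneg G N N
  have e5 := E_ind_nonneg G X X
  rw [e1, e2, e3] at this
  simp only [Finset.card_singleton, Nat.cast_one, ← hkdef, ← hcdef] at this
  have h1 : 0 ≤ (2 * k * c) * (-(k * c) + 4 * c + 9 * k + 6 * L) * 2 := by
    have a1 : 0 ≤ (2 * c) ^ 2 * E G (ind N) (ind N) := by positivity
    have a2 : 0 ≤ (-(3 * k)) ^ 2 * E G (ind X) (ind X) := by positivity
    have a3 : 0 ≤ (12 * c * k) * (L - E G (ind N) (ind X)) :=
      mul_nonneg (by positivity) (by linarith)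
    nlinarith
  have h2 : 0 ≤ -(k * c) + 4 * c + 9 * k + 6 * L := by
    by_contra hneg
    push Not at hneg
    have : (2 * k * c) * (-(k * c) + 4 * c + 9 * k + 6 * L) < 0 :=
      mul_neg_of_pos_of_neg (by positivity) hneg
    linarith
  linarith

/-- `K_{1,5}` test against an independent-from-it set. -/
lemma k15_test (G : SimpleGraph V) (h : PSD G) (v : V) (N X : Finset V)
    (hN : ∀ u ∈ N, G.Adj v u) (hN5 : N.card = 5) (hX : ∀ x ∈ X, x ≠ v ∧ ¬ G.Adj v x ∧ x ∉ N)
    (hNX : ∀ u ∈ N, ∀ x ∈ X, ¬ G.Adj u x) : X.card ≤ 45 := by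
  have hd1 : Disjoint {v} N := by
    simp only [Finset.disjoint_singleton_left]
    exact fun hv => (hN v hv).ne rfl
  have hd2 : Disjoint {v} X := by
    simp only [Finset.disjoint_singleton_left]
    exact fun hv => (hX v hv).1 rfl
  have hd3 : Disjoint N X := by
    rw [Finset.disjoint_left]
    intro x hx hx'
    exact (hX x hx').2.2 hx
  set c : ℝ := ((X.card : ℕ) : ℝ) with hcdef
  have := h ((5 * c) • ind {v} + (2 * c) • ind N + (-15 : ℝ) • ind X)
  rw [sum_three, Q_three G _ _ _ hd1 hd2 hd3] at this
  have e1 : E G (ind {v}) (ind N) = 5 := by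
    rw [E_single, Finset.filter_true_of_mem hN, hN5]; norm_num
  have e2 : E G (ind {v}) (ind X) = 0 :=
    E_ind_zero G _ _ (by simpa using fun x hx => (hX x hx).2.1)
  have e3 : E G (ind {v}) (ind {v}) = 0 := E_ind_zero G _ _ (by simp)
  have e6 : E G (ind N) (ind X) = 0 := E_ind_zero G _ _ hNX
  have e4 := E_ind_nonneg G N N
  have e5 := E_ind_nonneg G X X
  rw [e1, e2, e3, e6, hN5] at this
  simp only [Finset.card_singleton, Nat.cast_one, ← hcdef] at this
  by_contra hc
  push Not at hc
  have hcr : (46 : ℝ) ≤ c := by rw [hcdef]; exact_mod_cast hc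
  have a1 : 0 ≤ (2 * c) ^ 2 * E G (ind N) (ind N) := by positivity
  push_cast at this
  nlinarith

/-- The tree-like test. -/
lemma tree_test (G : SimpleGraph V) (P S : Finset V) (hd : Disjoint P S)
    (hP : 2 * ((P.card : ℝ) - 1) ≤ E G (ind P) (ind P))
    (hS : ∀ s ∈ S, ∃ p ∈ P, G.Adj s p) :
    Q G (ind P + (1 / 2 : ℝ) • ind S) ≤ 2 - (S.card : ℝ) / 2 ∧
    2 * ((P ∪ S).card - 1 : ℝ) ≤ E G (ind (P ∪ S)) (ind (P ∪ S)) := by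
  have e1 : (S.card : ℝ) ≤ E G (ind S) (ind P) := by
    rw [E_ind, Finset.card_eq_sum_ones, Nat.cast_sum]
    refine Finset.sum_le_sum fun s hs => ?_
    obtain ⟨p, hp, hsp⟩ := hS s hs
    have : 0 < (P.filter (G.Adj s)).card := Finset.card_pos.mpr ⟨p, by simp [hp, hsp]⟩
    exact_mod_cast this
  have e2 := E_ind_nonneg G S S
  have hu : ind (P ∪ S) = ind P + ind S := by
    funext v
    have : v ∈ P → v ∉ S := fun h => Finset.disjoint_left.mp hd h
    by_cases h1 : v ∈ P <;> by_cases h2 : v ∈ S <;> simp_all [ind]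
  constructor
  · have hz : ∑ v, ind P v * ((1 / 2 : ℝ) • ind S) v = 0 := by
      have := sum_ind_mul P S hd
      simp only [Pi.smul_apply, smul_eq_mul, mul_left_comm, ← Finset.mul_sum, this, mul_zero]
    rw [Q_add, Q_smul, Q_ind, Q_ind, E_smul_right, hz, E_comm G (ind P) (ind S)]
    linarith
  · rw [hu, E_add_left, E_add_right, E_add_right, E_comm G (ind P) (ind S),
      Finset.card_union_of_disjoint hd]
    push_cast
    linarith

/-- Dichotomy for the number of common neighbours. -/
lemma common_test (G : SimpleGraph V) (h : PSD G) (htf : ∀ a b c, G.Adj a b → G.Adj b c → ¬ G.Adj a c)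
    (v x : V) (hvx : v ≠ x) (hna : ¬ G.Adj v x) (N A : Finset V)
    (hN : N = univ.filter (G.Adj v)) (hA : A = N.filter (G.Adj x)) :
    ((A.card : ℝ) + 1) * (N.card - A.card) ≤ 4 * N.card + 24 := by
  set B := N.filter (fun y => ¬ G.Adj x y) with hB
  have hcard : A.card + B.card = N.card := by
    rw [hA, hB]; exact Finset.card_filter_add_card_filter_not _
  have hcr : (B.card : ℝ) = N.card - A.card := by rw [← hcard]; push_cast; ring
  have memA : ∀ y ∈ A, G.Adj v y ∧ G.Adj x y := by
    intro y hy; rw [hA, hN] at hy; simpa using hy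
  have memB : ∀ y ∈ B, G.Adj v y ∧ ¬ G.Adj x y := by
    intro y hy; rw [hB, hN] at hy; simpa using hy
  have dAB : Disjoint A B := by
    rw [Finset.disjoint_left]; exact fun y h1 h2 => (memB y h2).2 (memA y h1).2
  have dvA : Disjoint {v} A := by
    simp only [Finset.disjoint_singleton_left]; exact fun hv => (memA v hv).1.ne rfl
  have dvB : Disjoint {v} B := by
    simp only [Finset.disjoint_singleton_left]; exact fun hv => (memB v hv).1.ne rfl
  have dxA : Disjoint {x} A := by
    simp only [Finset.disjoint_singleton_left]; exact fun hv => (memA x hv).2.ne rfl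
  have dxB : Disjoint {x} B := by
    simp only [Finset.disjoint_singleton_left]; exact fun hv => hna (memB x hv).1
  set k : ℝ := ((N.card : ℕ) : ℝ) with hk
  set j : ℝ := ((A.card : ℕ) : ℝ) with hj
  have hkk : 0 ≤ k := by rw [hk]; positivity
  set w := (-(k + 2 - j)) • ind {v} + (k + 2 - j) • ind A + (-(j + 3)) • ind B with hw
  have hQw := Q_three G {v} A B dvA dvB dAB (-(k + 2 - j)) (k + 2 - j) (-(j + 3))
  have hsw := sum_three {v} A B (-(k + 2 - j)) (k + 2 - j) (-(j + 3))
  rw [← hw] at hQw hsw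
  have h1 := h ((2 * (k + 5)) • ind {x} + w)
  have f1 : ∑ u, ((2 * (k + 5)) • ind {x} + w) u = 2 * (k + 5) + ∑ u, w u := by
    simp only [Pi.add_apply, Pi.smul_apply, smul_eq_mul, Finset.sum_add_distrib, ← Finset.mul_sum,
      sum_ind]
    simp
  have wx : w x = 0 := by
    have i1 : x ∉ A := fun hv => (memA x hv).2.ne rfl
    have i2 : x ∉ B := fun hv => hna (memB x hv).1
    simp [hw, ind, i1, i2, hvx.symm]
  have f2 : ∑ u, ((2 * (k + 5)) • ind {x}) u * w u = 0 := by
    refine Finset.sum_eq_zero fun u _ => ?_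
    by_cases hu : u = x
    · rw [hu, wx, mul_zero]
    · simp [ind, hu]
  have gA : E G (ind {v}) (ind A) = j := by
    rw [E_single, Finset.filter_true_of_mem fun y hy => (memA y hy).1]
  have gB : E G (ind {v}) (ind B) = k - j := by
    rw [E_single, Finset.filter_true_of_mem fun y hy => (memB y hy).1, hcr]
  have gv : E G (ind {v}) (ind {v}) = 0 := E_ind_zero G _ _ (by simp)
  have gx : E G (ind {x}) (ind {x}) = 0 := E_ind_zero G _ _ (by simp)
  have gxv : E G (ind {x}) (ind {v}) = 0 :=
    E_ind_zero G _ _ (by simpa using fun h => hna h.symm)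
  have gxA : E G (ind {x}) (ind A) = j := by
    rw [E_single, Finset.filter_true_of_mem fun y hy => (memA y hy).2]
  have gxB : E G (ind {x}) (ind B) = 0 :=
    E_ind_zero G _ _ (by simpa using fun y hy => (memB y hy).2)
  have gAA : E G (ind A) (ind A) = 0 :=
    E_ind_zero G _ _ fun a ha b hb hab => htf v a b (memA a ha).1 hab (memA b hb).1
  have gAB : E G (ind A) (ind B) = 0 :=
    E_ind_zero G _ _ fun a ha b hb hab => htf v a b (memA a ha).1 hab (memB b hb).1
  have gBB : E G (ind B) (ind B) = 0 :=
    E_ind_zero G _ _ fun a ha b hb hab => htf v a b (memB a ha).1 hab (memB b hb).1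
  have f3 : E G (ind {x}) w = (k + 2 - j) * j := by
    rw [hw, E_add_right, E_add_right, E_smul_right, E_smul_right, E_smul_right, gxv, gxA, gxB]
    ring
  rw [f1, Q_add, f2, Q_smul, E_smul_left, f3, Q_ind, gx, hQw, hsw, gA, gB, gv, gAA, gAB, gBB] at h1
  simp only [Finset.card_singleton, Nat.cast_one, hcr, ← hj] at h1
  have h2 : 0 ≤ (4 * (k + 5)) * (4 * k + 24 - (j + 1) * (k - j)) := by
    refine h1.trans (le_of_eq ?_)
    ring
  have h3 := nonneg_of_mul_nonneg_right h2 (by linarith)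
  linarith
end TF

/-! ### Graphs of maximum degree at most four -/
namespace TF
open Finset
open scoped Classical
set_option linter.unusedSectionVars false

variable {V : Type*} [Fintype V]

lemma zero_spread (G : SimpleGraph V) (h : V → ℝ) (hn : ∀ v, 0 ≤ h v) (u v : V)
    (hk : 2 * h u = ∑ v, if G.Adj u v then h v else 0) (hu : h u = 0) (ha : G.Adj u v) :
    h v = 0 := by
  rw [hu, mul_zero] at hk
  have := (Finset.sum_eq_zero_iff_of_nonneg (fun w _ => by
    split_ifs
    · exact hn w
    · exact le_rfl)).mp hk.symm v (Finset.mem_univ v)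
  simpa [ha] using this

lemma four_of_kernel (G : SimpleGraph V) (htf : ∀ a b c, G.Adj a b → G.Adj b c → ¬ G.Adj a c)
    (h : V → ℝ)
    (hk : ∀ u, 2 * h u = ∑ v, if G.Adj u v then h v else 0) (v0 : V) (hv0 : 0 < h v0) :
    4 ≤ (univ.filter (fun u => G.Reachable v0 u)).card := by
  set S := univ.filter (fun u => G.Reachable v0 u) with hS
  have memS : ∀ u, u ∈ S ↔ G.Reachable v0 u := by intro u; simp [hS]
  obtain ⟨v, hvS, hmax⟩ := Finset.exists_max_image S h ⟨v0, by simp [hS]⟩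
  have hvpos : 0 < h v := lt_of_lt_of_le hv0 (hmax v0 (by simp [hS]))
  have clos : ∀ a ∈ S, ∀ b, G.Adj a b → b ∈ S := by
    intro a ha b hab
    rw [memS] at *
    exact ha.trans hab.reachable
  -- two neighbours for every maximal vertex
  have two : ∀ w ∈ S, h w = h v → 2 ≤ (univ.filter (G.Adj w)).card := by
    intro w hw hwv
    have h1 := hk w
    rw [← Finset.sum_filter] at h1
    have h2 : ∑ u ∈ univ.filter (G.Adj w), h u ≤ (univ.filter (G.Adj w)).card • h v :=
      Finset.sum_le_card_nsmul _ _ _ fun u hu => hmax u (clos w hw u (by simpa using hu))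
    rw [nsmul_eq_mul] at h2
    have h3 : 2 * h v ≤ ((univ.filter (G.Adj w)).card : ℝ) * h v := by
      calc 2 * h v = 2 * h w := by rw [hwv]
        _ = _ := h1
        _ ≤ _ := h2
    have h4 := le_of_mul_le_mul_right h3 hvpos
    exact_mod_cast h4
  have h2 := two v hvS rfl
  have sub : insert v (univ.filter (G.Adj v)) ⊆ S := by
    intro u hu
    rw [Finset.mem_insert] at hu
    rcases hu with rfl | hu
    · exact hvS
    · exact clos v hvS u (by simpa using hu)
  have hcard : (insert v (univ.filter (G.Adj v))).card = (univ.filter (G.Adj v)).card + 1 :=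
    Finset.card_insert_of_notMem (by simp)
  rcases Nat.lt_or_ge 2 (univ.filter (G.Adj v)).card with h3 | h3
  · have := Finset.card_le_card sub
    omega
  · have heq : (univ.filter (G.Adj v)).card = 2 := le_antisymm h3 h2
    obtain ⟨a, b, hab, hs⟩ := Finset.card_eq_two.mp heq
    have hva : G.Adj v a := by
      have : a ∈ univ.filter (G.Adj v) := by rw [hs]; simp
      simpa using this
    have hvb : G.Adj v b := by
      have : b ∈ univ.filter (G.Adj v) := by rw [hs]; simp
      simpa using this
    have haS := clos v hvS a hva
    have hbS := clos v hvS b hvb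
    have h1 := hk v
    rw [← Finset.sum_filter, hs, Finset.sum_pair hab] at h1
    have ha1 : h a = h v := by
      have := hmax a haS
      have := hmax b hbS
      linarith
    have h4 := two a haS ha1
    obtain ⟨c, hc, hcv⟩ := Finset.exists_mem_ne (by omega : 1 < (univ.filter (G.Adj a)).card) v
    have hac : G.Adj a c := by simpa using hc
    have hcS := clos a haS c hac
    have hcb : c ≠ b := by
      rintro rfl
      exact htf v a c hva hac hvb
    have hca : c ≠ a := hac.ne.symm
    have : ({v, a, b, c} : Finset V) ⊆ S := by
      intro u hu
      simp only [Finset.mem_insert, Finset.mem_singleton] at hu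
      rcases hu with rfl | rfl | rfl | rfl <;> assumption
    have h5 := Finset.card_le_card this
    rw [Finset.card_insert_of_notMem, Finset.card_insert_of_notMem,
      Finset.card_insert_of_notMem, Finset.card_singleton] at h5
    · exact h5
    · simp [hcb.symm]
    · simp [hab, hca.symm]
    · simp [hva.ne, hvb.ne, hcv.symm]

lemma low_psd (G : SimpleGraph V) (htf : ∀ a b c, G.Adj a b → G.Adj b c → ¬ G.Adj a c)
    (hQ : ∀ x, 0 ≤ Q G x) :
    ∃ T : Finset V, 4 * T.card ≤ Fintype.card V ∧
      ∀ z : V → ℝ, (∀ t ∈ T, z t = 0) → (∑ v, z v) ^ 2 + 2 * Q G z ≤ 0 → z = 0 := by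
  choose rep hrep using fun c : G.ConnectedComponent => c.exists_rep
  have hrep' : ∀ v, G.Reachable v (rep (G.connectedComponentMk v)) := by
    intro v
    have := hrep (G.connectedComponentMk v)
    exact (SimpleGraph.ConnectedComponent.exact this).symm
  set T : Finset V := univ.filter fun v =>
    rep (G.connectedComponentMk v) = v ∧ 4 ≤ (univ.filter (fun u => G.Reachable v u)).card with hT
  refine ⟨T, ?_, ?_⟩
  · have hdisj : (T : Set V).PairwiseDisjoint (fun v => univ.filter (fun u => G.Reachable v u)) := by
      intro a ha b hb hab
      rw [Function.onFun, Finset.disjoint_left]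
      intro u hu hu'
      simp only [hT, Finset.coe_filter, Finset.mem_filter, Finset.mem_univ, true_and,
        Set.mem_ofPred_eq] at ha hb hu hu'
      apply hab
      rw [← ha.1, ← hb.1]
      congr 1
      exact SimpleGraph.ConnectedComponent.sound (hu.trans hu'.symm)
    have h1 := Finset.card_biUnion hdisj
    have h2 : T.card • 4 ≤ ∑ v ∈ T, (univ.filter (fun u => G.Reachable v u)).card :=
      Finset.card_nsmul_le_sum _ _ _ fun v hv => by
        simp only [hT, Finset.mem_filter] at hv
        exact hv.2.2
    have h3 := Finset.card_le_univ (T.biUnion fun v => univ.filter (fun u => G.Reachable v u))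
    rw [smul_eq_mul] at h2
    omega
  · intro z hz hform
    have hz0 : Q G z ≤ 0 := by nlinarith [sq_nonneg (∑ v, z v)]
    have habs : Q G (fun v => |z v|) ≤ 0 := (Q_abs G z).trans hz0
    have hk : ∀ u, 2 * |z u| = ∑ v, if G.Adj u v then |z v| else 0 := fun u =>
      kernel_of_min G univ (fun x _ => hQ x) (fun v => |z v|) (by simp) habs u (by simp)
    have spread : ∀ u v, G.Reachable u v → |z u| = 0 → |z v| = 0 := by
      rintro u v ⟨p⟩
      induction p with
      | nil => exact id
      | cons ha _ ih =>
        intro h0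
        exact ih (zero_spread G (fun v => |z v|) (fun v => abs_nonneg _) _ _ (hk _) h0 ha)
    funext v
    by_contra hv
    have hv' : 0 < |z v| := abs_pos.mpr hv
    set r := rep (G.connectedComponentMk v) with hr
    have hrv : G.Reachable v r := hrep' v
    have hr0 : 0 < |z r| := by
      rcases (abs_nonneg (z r)).lt_or_eq with h | h
      · exact h
      · exact absurd (spread r v hrv.symm h.symm) hv'.ne'
    have h4 := four_of_kernel G htf (fun v => |z v|) hk r hr0
    have : r ∈ T := by
      simp only [hT, Finset.mem_filter, Finset.mem_univ, true_and]
      refine ⟨?_, h4⟩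
      have : G.connectedComponentMk r = G.connectedComponentMk v :=
        SimpleGraph.ConnectedComponent.sound hrv.symm
      rw [this]
    rw [hz r this] at hr0
    simp at hr0

/-- Balls around a vertex. -/
noncomputable def ball (G : SimpleGraph V) (w : V) : ℕ → Finset V
  | 0 => {w}
  | i + 1 => ball G w i ∪ univ.filter (fun u => ∃ p ∈ ball G w i, G.Adj u p)

lemma ball_mono (G : SimpleGraph V) (w : V) {i j : ℕ} (h : i ≤ j) : ball G w i ⊆ ball G w j := by
  induction h with
  | refl => exact Finset.Subset.refl _
  | step _ ih => exact ih.trans Finset.subset_union_left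

lemma ball_adj (G : SimpleGraph V) (w : V) (i : ℕ) {u p : V} (hp : p ∈ ball G w i)
    (h : G.Adj u p) : u ∈ ball G w (i + 1) :=
  Finset.mem_union_right _ (by simpa using ⟨p, hp, h⟩)

/-- Spheres. -/
noncomputable def sph (G : SimpleGraph V) (w : V) (i : ℕ) : Finset V :=
  ball G w (i + 1) \ ball G w i

lemma sph_nbr (G : SimpleGraph V) (w : V) (i : ℕ) {u : V} (h : u ∈ sph G w i) :
    ∃ p ∈ ball G w i, G.Adj u p := by
  rw [sph, Finset.mem_sdiff, ball, Finset.mem_union] at h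
  rcases h with ⟨h | h, h'⟩
  · exact absurd h h'
  · simpa using h

lemma ball_succ (G : SimpleGraph V) (w : V) (i : ℕ) : ball G w (i + 1) = ball G w i ∪ sph G w i := by
  rw [sph, Finset.union_sdiff_of_subset (ball_mono G w (Nat.le_succ i))]

lemma ball_edges (G : SimpleGraph V) (w : V) (i : ℕ) :
    2 * (((ball G w i).card : ℝ) - 1) ≤ E G (ind (ball G w i)) (ind (ball G w i)) := by
  induction i with
  | zero =>
    have := E_ind_nonneg G {w} {w}
    simpa [ball] using this
  | succ i ih =>
    rw [ball_succ]
    exact (tree_test G _ _ Finset.disjoint_sdiff ih fun s hs => sph_nbr G w i hs).2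

lemma sph_next (G : SimpleGraph V) (w : V) (i : ℕ) (hd : ∀ v, (univ.filter (G.Adj v)).card ≤ 4) :
    (sph G w (i + 1)).card ≤ 3 * (sph G w i).card := by
  have hsub : sph G w (i + 1) ⊆
      (sph G w i).biUnion fun p => (univ.filter (G.Adj p)) \ ball G w i := by
    intro u hu
    obtain ⟨p, hp, hup⟩ := sph_nbr G w _ hu
    have hu2 : u ∉ ball G w (i + 1) := (Finset.mem_sdiff.mp hu).2
    have hu3 : u ∉ ball G w i := fun h => hu2 (ball_mono G w (Nat.le_succ i) h)
    rw [Finset.mem_biUnion]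
    refine ⟨p, ?_, ?_⟩
    · rw [sph, Finset.mem_sdiff]
      exact ⟨hp, fun h => hu2 (ball_adj G w i h hup)⟩
    · simp [hu3, hup.symm]
  refine (Finset.card_le_card hsub).trans ?_
  rw [mul_comm]
  refine Finset.card_biUnion_le_card_mul _ _ _ fun p hp => ?_
  obtain ⟨q, hq, hpq⟩ := sph_nbr G w i hp
  have : (univ.filter (G.Adj p)) \ ball G w i ⊂ univ.filter (G.Adj p) := by
    rw [Finset.ssubset_iff_of_subset Finset.sdiff_subset]
    exact ⟨q, by simpa using hpq, by simp [hq]⟩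
  have := Finset.card_lt_card this
  have := hd p
  omega

lemma reach_ball (G : SimpleGraph V) (w u : V) (h : G.Reachable u w) : ∃ i, u ∈ ball G w i := by
  obtain ⟨p⟩ := h
  induction p with
  | nil => exact ⟨0, by simp [ball]⟩
  | cons ha _ ih =>
    obtain ⟨i, hi⟩ := ih
    exact ⟨i + 1, ball_adj G _ i hi ha⟩

lemma exists_ball (G : SimpleGraph V) (hQ : ∃ x, Q G x < 0) :
    ∃ w i, ∃ x : V → ℝ, (∀ v, v ∉ ball G w i → x v = 0) ∧ Q G x < 0 := by
  have hne : ∃ m : ℕ, ∃ S : Finset V, S.card = m ∧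
      ∃ x : V → ℝ, (∀ v, v ∉ S → x v = 0) ∧ Q G x < 0 := by
    obtain ⟨x, hx⟩ := hQ
    exact ⟨_, univ, rfl, x, by simp, hx⟩
  obtain ⟨S, hSc, x, hxS, hx⟩ := Nat.find_spec hne
  have hmin : ∀ S' : Finset V, S'.card < S.card → ∀ x : V → ℝ, (∀ v, v ∉ S' → x v = 0) →
      0 ≤ Q G x := by
    intro S' hlt y hy
    by_contra hneg
    exact Nat.find_min hne (m := S'.card) (by omega) ⟨S', rfl, y, hy, not_le.mp hneg⟩
  have hSne : S.Nonempty := by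
    by_contra hS
    rw [Finset.not_nonempty_iff_eq_empty] at hS
    have : x = 0 := by funext v; exact hxS v (by simp [hS])
    rw [this] at hx
    simp [Q, E] at hx
  obtain ⟨w, hw⟩ := hSne
  set K := univ.filter (fun u => G.Reachable w u) with hK
  have memK : ∀ u, u ∈ K ↔ G.Reachable w u := by intro u; simp [hK]
  have hsplit : x = res K x + res Kᶜ x := by
    funext v
    by_cases hv : v ∈ K <;> simp [res, hv]
  have hQs : Q G x = Q G (res K x) + Q G (res Kᶜ x) := by
    conv_lhs => rw [hsplit]
    refine Q_split G _ _ ?_ ?_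
    · intro v h1 h2
      have := mem_of_res h2
      rw [Finset.mem_compl] at this
      exact this (mem_of_res h1)
    · intro u v ha h1 h2
      have h2 := mem_of_res h2
      rw [Finset.mem_compl, memK] at h2
      have h1 := mem_of_res h1
      rw [memK] at h1
      exact h2 (h1.trans ha.reachable)
  have h2 : 0 ≤ Q G (res Kᶜ x) := by
    refine hmin (S.erase w) (Finset.card_erase_lt_of_mem hw) _ ?_
    intro v hv
    rw [Finset.mem_erase] at hv
    by_cases hvw : v = w
    · subst hvw
      simp [res, hK]
    · have : v ∉ S := fun h => hv ⟨hvw, h⟩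
      simp [res, hxS v this]
  have h1 : Q G (res K x) < 0 := by linarith
  -- the component is contained in a ball
  have hin : ∀ u, G.Reachable u w → ∃ i, u ∈ ball G w i := fun u hu => reach_ball G w u hu
  choose! f hf using hin
  refine ⟨w, univ.sup f, res K x, ?_, h1⟩
  intro v hv
  by_contra hne
  have hvK := mem_of_res hne
  rw [memK] at hvK
  exact hv (ball_mono G w (Finset.le_sup (Finset.mem_univ v)) (hf v hvK.symm))

lemma low_main (G : SimpleGraph V) (h : PSD G)
    (htf : ∀ a b c, G.Adj a b → G.Adj b c → ¬ G.Adj a c)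
    (hd : ∀ v, (univ.filter (G.Adj v)).card ≤ 4) :
    ∃ T : Finset V, (T.card ≤ 65 ∨ 4 * T.card ≤ Fintype.card V) ∧
      ∀ z : V → ℝ, (∀ t ∈ T, z t = 0) → (∑ v, z v) ^ 2 + 2 * Q G z ≤ 0 → z = 0 := by
  by_cases hQ : ∀ x, 0 ≤ Q G x
  · obtain ⟨T, h1, h2⟩ := low_psd G htf hQ
    exact ⟨T, Or.inr h1, h2⟩
  push Not at hQ
  obtain ⟨w, hw⟩ := exists_ball G hQ
  obtain ⟨x, hxs, hx⟩ := Nat.find_spec hw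
  have hmin : ∀ j < Nat.find hw, ∀ y : V → ℝ, (∀ v, v ∉ ball G w j → y v = 0) → 0 ≤ Q G y := by
    intro j hj y hy
    by_contra hneg
    exact Nat.find_min hw hj ⟨y, hy, not_le.mp hneg⟩
  generalize Nat.find hw = i at hxs hmin
  -- the radius is positive
  cases i with
  | zero =>
    exfalso
    have : x = (x w) • ind {w} := by
      funext v
      by_cases hv : v = w
      · subst hv; simp [ind]
      · simp [ind, hv, hxs v (by simp [ball, hv])]
    rw [this, Q_smul, Q_ind, E_ind_zero] at hx
    · have := sq_nonneg (x w)
      simp at hx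
      nlinarith
    · simp
  | succ i =>
  have hPi : ∀ y : V → ℝ, (∀ v, v ∉ ball G w i → y v = 0) → 0 ≤ Q G y := hmin i (Nat.lt_succ_self i)
  have hsi : (sph G w i).card ≤ 16 := by
    cases i with
    | zero =>
      have : sph G w 0 ⊆ univ.filter (G.Adj w) := by
        intro u hu
        obtain ⟨p, hp, hup⟩ := sph_nbr G w 0 hu
        simp only [ball, Finset.mem_singleton] at hp
        subst hp
        simpa using hup.symm
      have := Finset.card_le_card this
      have := hd w
      omega
    | succ j =>
      have h1 := (tree_test G (ball G w j) (sph G w j) Finset.disjoint_sdiff (ball_edges G w j)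
        fun s hs => sph_nbr G w j hs).1
      have h2 := hPi (ind (ball G w j) + (1 / 2 : ℝ) • ind (sph G w j)) (by
        intro v hv
        rw [ball_succ, Finset.mem_union, not_or] at hv
        simp [ind, hv.1, hv.2])
      have h3 : ((sph G w j).card : ℝ) ≤ 4 := by linarith
      have h4 : (sph G w j).card ≤ 4 := by exact_mod_cast h3
      have := sph_next G w j hd
      omega
  have hsi1 := sph_next G w i hd
  refine ⟨{w} ∪ (sph G w i ∪ sph G w (i + 1)), Or.inl ?_, ?_⟩
  · have h1 := Finset.card_union_le {w} (sph G w i ∪ sph G w (i + 1))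
    have h2 := Finset.card_union_le (sph G w i) (sph G w (i + 1))
    rw [Finset.card_singleton] at h1
    omega
  intro z hz hform
  have hzw : z w = 0 := hz w (by simp)
  have hzs : ∀ v, v ∈ ball G w (i + 2) → v ∉ ball G w i → z v = 0 := by
    intro v h1 h2
    apply hz
    rw [ball_succ, ball_succ, Finset.mem_union, Finset.mem_union] at h1
    simp only [Finset.mem_union]
    tauto
  set P := ball G w i with hPdef
  set R := (ball G w (i + 2))ᶜ with hRdef
  have hPR : ∀ v, v ∈ P → v ∈ R → False := by
    intro v h1 h2
    rw [hRdef, Finset.mem_compl] at h2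
    exact h2 (ball_mono G w (by omega) h1)
  have hsplit : z = res P z + res R z := by
    funext v
    by_cases h1 : v ∈ P
    · have h2 : v ∉ R := fun h => hPR v h1 h
      simp [res, h1, h2]
    · by_cases h2 : v ∈ R
      · simp [res, h1, h2]
      · have : z v = 0 := hzs v (by simpa [hRdef] using h2) h1
        simp [res, h1, h2, this]
  have hQs : Q G z = Q G (res P z) + Q G (res R z) := by
    conv_lhs => rw [hsplit]
    refine Q_split G _ _ (fun v h1 h2 => hPR v (mem_of_res h1) (mem_of_res h2)) ?_
    intro u v ha h1 h2
    have h1 := mem_of_res h1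
    have h2 := mem_of_res h2
    rw [hRdef, Finset.mem_compl] at h2
    exact h2 (ball_mono G w (by omega) (ball_adj G w i h1 ha.symm))
  -- a nonnegative witness
  set x' : V → ℝ := fun v => |x v| with hx'
  have hx'Q : Q G x' < 0 := (Q_abs G x).trans_lt hx
  have hx's : ∀ v, v ∉ ball G w (i + 1) → x' v = 0 := by
    intro v hv; simp [hx', hxs v hv]
  have hσ : 0 < ∑ v, x' v := by
    rcases (Finset.sum_nonneg (fun v _ => abs_nonneg (x v)) : 0 ≤ ∑ v, x' v).lt_or_eq with h1 | h1
    · exact h1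
    · exfalso
      have h2 := (Finset.sum_eq_zero_iff_of_nonneg (fun v _ => abs_nonneg (x v))).mp h1.symm
      have : x' = 0 := by funext v; exact h2 v (Finset.mem_univ v)
      rw [this] at hx'Q
      simp [Q, E] at hx'Q
  -- bound for vectors supported on R
  have hR : ∀ y : V → ℝ, (∀ v, v ∉ R → y v = 0) →
      -((∑ v, y v) / ∑ v, x' v) ^ 2 * Q G x' ≤ Q G y := by
    intro y hy
    set c := -((∑ v, y v) / ∑ v, x' v) with hc
    have h1 := h (c • x' + y)
    have h2 : ∑ v, (c • x' + y) v = 0 := by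
      simp only [Pi.add_apply, Pi.smul_apply, smul_eq_mul, Finset.sum_add_distrib,
        ← Finset.mul_sum, hc]
      field_simp
      ring
    have h3 : Q G (c • x' + y) = Q G (c • x') + Q G y := by
      have inx : ∀ v, (c • x') v ≠ 0 → v ∈ ball G w (i + 1) := by
        intro v hv
        by_contra hb
        exact hv (by simp [hx's v hb])
      have iny : ∀ v, y v ≠ 0 → v ∉ ball G w (i + 2) := by
        intro v hv
        by_contra hb
        exact hv (hy v (by simpa [hRdef] using hb))
      refine Q_split G _ _ (fun v a b => iny v b (ball_mono G w (by omega) (inx v a))) ?_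
      intro u v ha a b
      exact iny v b (ball_adj G w (i + 1) (inx u a) ha.symm)
    rw [h2, h3, Q_smul] at h1
    have h4 : ((∑ v, y v) / ∑ v, x' v) ^ 2 = c ^ 2 := by rw [hc]; ring
    rw [neg_mul, h4]
    linarith
  have hR0 : ∀ y : V → ℝ, (∀ v, v ∉ R → y v = 0) → 0 ≤ Q G y := by
    intro y hy
    refine le_trans ?_ (hR y hy)
    nlinarith [sq_nonneg ((∑ v, y v) / ∑ v, x' v)]
  have resR : ∀ v, v ∉ R → res R z v = 0 := by intro v hv; simp [res, hv]
  have resP : ∀ v, v ∉ P → res P z v = 0 := by intro v hv; simp [res, hv]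
  have q1 := hR0 _ resR
  have q2 := hPi _ resP
  have q3 := sq_nonneg (∑ v, z v)
  have qR : Q G (res R z) ≤ 0 := by linarith
  have qP : Q G (res P z) ≤ 0 := by linarith
  -- the part on R vanishes
  have zR : ∀ v, res R z v = 0 := by
    have h1 := (Q_abs G (res R z)).trans qR
    have h2 := hR (fun v => |res R z v|) (fun v hv => by simp [resR v hv])
    have h3 : ((∑ v, |res R z v|) / ∑ v, x' v) ^ 2 = 0 := by
      have := sq_nonneg ((∑ v, |res R z v|) / ∑ v, x' v)
      nlinarith
    have h4 : ∑ v, |res R z v| = 0 := by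
      rw [sq_eq_zero_iff, div_eq_zero_iff] at h3
      exact h3.resolve_right hσ.ne'
    intro v
    have := (Finset.sum_eq_zero_iff_of_nonneg (fun v _ => abs_nonneg (res R z v))).mp h4 v
      (Finset.mem_univ v)
    exact abs_eq_zero.mp this
  -- the part on P vanishes
  have hk : ∀ u ∈ P, 2 * |res P z u| = ∑ v, if G.Adj u v then |res P z v| else 0 := fun u hu =>
    kernel_of_min G P hPi (fun v => |res P z v|) (fun v hv => by simp [resP v hv])
      ((Q_abs G (res P z)).trans qP) u hu
  have zP : ∀ j ≤ i, ∀ v ∈ ball G w j, |res P z v| = 0 := by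
    intro j
    induction j with
    | zero =>
      intro _ v hv
      simp only [ball, Finset.mem_singleton] at hv
      subst hv
      simp [res, hzw]
    | succ j ih =>
      intro hj v hv
      rw [ball_succ, Finset.mem_union] at hv
      rcases hv with hv | hv
      · exact ih (by omega) v hv
      · obtain ⟨p, hp, hvp⟩ := sph_nbr G w j hv
        exact zero_spread G (fun v => |res P z v|) (fun v => abs_nonneg _) p v
          (hk p (ball_mono G w (by omega) hp)) (ih (by omega) p hp) hvp.symm
  funext v
  rw [hsplit]
  simp only [Pi.add_apply, zR v, add_zero, Pi.zero_apply]
  by_cases hv : v ∈ P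
  · exact abs_eq_zero.mp (zP i le_rfl v hv)
  · exact resP v hv
end TF

/-! ### The combinatorial core -/
namespace TF
open Finset
open scoped Classical
set_option linter.unusedSectionVars false

variable {V : Type*} [Fintype V]

/-- Entries of `J + 4 I - 2 A`. -/
noncomputable def mat (G : SimpleGraph V) (u v : V) : ℝ :=
  1 + (if u = v then 4 else 0) - (if G.Adj u v then 2 else 0)

lemma form_eq (G : SimpleGraph V) (y : V → ℝ) :
    (∑ v, y v) ^ 2 + 2 * Q G y = ∑ u, ∑ v, mat G u v * (y u * y v) := by
  have h1 : ∀ u v, mat G u v * (y u * y v) = y u * y v + 4 * (if u = v then y u * y v else 0)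
      - 2 * (if G.Adj u v then y u * y v else 0) := by
    intro u v; unfold mat; split_ifs <;> ring
  simp only [h1, Finset.sum_sub_distrib, Finset.sum_add_distrib, ← Finset.mul_sum]
  unfold Q E
  rw [← Finset.sum_mul]
  simp only [Finset.sum_ite_eq, Finset.mem_univ, if_true, ← sq]
  ring

lemma sum_off (C : Finset V) (f : V → ℝ) (hf : ∀ v ∈ C, f v = 0) :
    ∑ v, f v = ∑ a : {x // x ∉ C}, f a := by
  rw [← Finset.sum_subset (Finset.subset_univ Cᶜ)]
  · exact Finset.sum_subtype Cᶜ (by simp) f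
  · intro v _ hv
    exact hf v (by simpa using hv)

lemma form_transfer (G : SimpleGraph V) (C : Finset V) (H : SimpleGraph {x // x ∉ C}) (s : V → ℝ)
    (hs : ∀ v, s v * s v = 1)
    (hm : ∀ a b : {x // x ∉ C}, mat G a b = mat H a b * (s a * s b)) (z : V → ℝ)
    (hz : ∀ v ∈ C, z v = 0) :
    (∑ v, z v) ^ 2 + 2 * Q G z
      = (∑ a : {x // x ∉ C}, s a * z a) ^ 2 + 2 * Q H (fun a => s a * z a) := by
  rw [form_eq, form_eq, sum_off C _ (by intro v hv; simp [hz v hv])]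
  refine Finset.sum_congr rfl fun a _ => ?_
  rw [sum_off C _ (by intro v hv; simp [hz v hv])]
  refine Finset.sum_congr rfl fun b _ => ?_
  rw [hm]
  ring

set_option maxHeartbeats 2000000 in
theorem core (G : SimpleGraph V) (h : PSD G)
    (htf : ∀ a b c, G.Adj a b → G.Adj b c → ¬ G.Adj a c) (hn : 277 ≤ Fintype.card V) :
    ∃ T : Finset V, 3 * T.card + 3 ≤ Fintype.card V ∧
      ∀ z : V → ℝ, (∀ t ∈ T, z t = 0) → (∑ v, z v) ^ 2 + 2 * Q G z ≤ 0 → z = 0 := by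
  by_cases hd : ∀ v, (univ.filter (G.Adj v)).card ≤ 4
  · obtain ⟨T, h1, h2⟩ := low_main G h htf hd
    exact ⟨T, by omega, h2⟩
  push Not at hd
  obtain ⟨v0, hv0⟩ := hd
  obtain ⟨v, -, hmax⟩ := Finset.exists_max_image univ (fun v => (univ.filter (G.Adj v)).card)
    ⟨v0, Finset.mem_univ _⟩
  set N := univ.filter (G.Adj v) with hN
  have memN : ∀ y, y ∈ N ↔ G.Adj v y := by intro y; simp [hN]
  have hk5 : 5 ≤ N.card := by
    have := hmax v0 (Finset.mem_univ _)
    omega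
  have hmax' : ∀ u, (univ.filter (G.Adj u)).card ≤ N.card := fun u => hmax u (Finset.mem_univ u)
  set X := univ.filter (fun x => x ≠ v ∧ ¬ G.Adj v x) with hX
  have memX : ∀ y, y ∈ X ↔ y ≠ v ∧ ¬ G.Adj v y := by intro y; simp [hX]
  have hXcard : X.card + N.card + 1 = Fintype.card V := by
    have e : X = (insert v N)ᶜ := by
      ext y; simp [hX, hN]
    have hvN : v ∉ N := by simp [hN]
    have := Finset.card_add_card_compl (insert v N)
    rw [Finset.card_insert_of_notMem hvN, ← e] at this
    omega
  -- Step 1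
  have hk36 : 36 ≤ N.card := by
    have hL : E G (ind N) (ind X) ≤ (N.card : ℝ) * (N.card - 1) := by
      rw [E_ind]
      have : ∀ u ∈ N, ((X.filter (G.Adj u)).card : ℝ) ≤ (N.card : ℝ) - 1 := by
        intro u hu
        have hss : X.filter (G.Adj u) ⊂ univ.filter (G.Adj u) := by
          rw [Finset.ssubset_iff_of_subset (Finset.filter_subset_filter _ (Finset.subset_univ _))]
          refine ⟨v, by simpa using ((memN u).mp hu).symm, ?_⟩
          simp [hX]
        have h1 := Finset.card_lt_card hss
        have h2 := hmax' u
        have h3 : (X.filter (G.Adj u)).card + 1 ≤ N.card := by omega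
        have h4 : ((X.filter (G.Adj u)).card : ℝ) + 1 ≤ N.card := by exact_mod_cast h3
        linarith
      have := Finset.sum_le_card_nsmul _ _ _ this
      rwa [nsmul_eq_mul] at this
    have h1 := star_test G h v N X hN (fun x hx => (memX x).mp hx) _ hL (by omega)
    by_contra hlt
    have h2 : (X.card : ℝ) + N.card + 1 ≥ 277 := by exact_mod_cast (by omega)
    have h3 : (N.card : ℝ) ≤ 35 := by exact_mod_cast (by omega)
    have h4 : (5 : ℝ) ≤ N.card := by exact_mod_cast hk5
    nlinarith
  set jx : V → ℕ := fun x => (N.filter (G.Adj x)).card with hjx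
  have hcom : ∀ x ∈ X, ((jx x : ℝ) + 1) * (N.card - jx x) ≤ 4 * N.card + 24 := by
    intro x hx
    have := (memX x).mp hx
    exact common_test G h htf v x this.1.symm this.2 N _ hN rfl
  have hjle : ∀ x, jx x ≤ N.card := fun x => Finset.card_filter_le _ _
  set C := X.filter (fun x => jx x ≤ 4) with hC
  set B := univ.filter (fun x => x ∉ N ∧ x ∉ C) with hB
  have memB : ∀ y, y ∈ B ↔ y ∉ N ∧ y ∉ C := by intro y; simp [hB]
  have CX : ∀ y ∈ C, y ∈ X := fun y hy => (Finset.mem_filter.mp hy).1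
  have hNC : Disjoint N C := by
    rw [Finset.disjoint_left]
    intro y h1 h2
    exact ((memX y).mp (CX y h2)).2 ((memN y).mp h1)
  have hsum : N.card + B.card + C.card = Fintype.card V := by
    have e : B = (N ∪ C)ᶜ := by
      ext y; simp [hB]
    have := Finset.card_add_card_compl (N ∪ C)
    rw [Finset.card_union_of_disjoint hNC, ← e] at this
    omega
  have jv : jx v = N.card := by
    simp only [hjx]
    rw [Finset.filter_true_of_mem fun y hy => (memN y).mp hy]
  have BX : ∀ b ∈ B, b ≠ v → b ∈ X ∧ 5 ≤ jx b := by
    intro b hb hbv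
    have := (memB b).mp hb
    have hbX : b ∈ X := (memX b).mpr ⟨hbv, fun h => this.1 ((memN b).mpr h)⟩
    refine ⟨hbX, ?_⟩
    by_contra hlt
    exact this.2 (by simp only [hC, Finset.mem_filter]; exact ⟨hbX, by omega⟩)
  have hkr36 : (36 : ℝ) ≤ N.card := by exact_mod_cast hk36
  have hB5 : ∀ b ∈ B, N.card - 5 ≤ jx b := by
    intro b hb
    by_cases hbv : b = v
    · rw [hbv, jv]; omega
    obtain ⟨hbX, h5⟩ := BX b hb hbv
    have h1 := hcom b hbX
    by_contra hlt
    have h2 : jx b + 6 ≤ N.card := by omega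
    have h3 : (jx b : ℝ) + 6 ≤ N.card := by exact_mod_cast h2
    have h4 : (5 : ℝ) ≤ jx b := by exact_mod_cast h5
    nlinarith [mul_nonneg (sub_nonneg.mpr h4) (sub_nonneg.mpr h3)]
  have hCk : C.card * N.card ≤ 9 * N.card + 28 * C.card := by
    have hL : E G (ind N) (ind C) ≤ 4 * (C.card : ℝ) := by
      rw [E_comm, E_ind]
      have : ∀ u ∈ C, ((N.filter (G.Adj u)).card : ℝ) ≤ 4 := by
        intro u hu
        exact_mod_cast (Finset.mem_filter.mp hu).2
      have := Finset.sum_le_card_nsmul _ _ _ this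
      rw [nsmul_eq_mul] at this
      linarith
    have h1 := star_test G h v N C hN (fun x hx => (memX x).mp (CX x hx)) _ hL (by omega)
    have h2 : (C.card : ℝ) * N.card ≤ 9 * N.card + 28 * C.card := by linarith
    exact_mod_cast h2
  have hBk : B.card * (N.card - 5) ≤ N.card * N.card := by
    have h1 : (B.card * (N.card - 5) : ℕ) ≤ ∑ b ∈ B, jx b := by
      have := Finset.card_nsmul_le_sum B jx (N.card - 5) hB5
      simpa using this
    have h2 : ((∑ b ∈ B, jx b : ℕ) : ℝ) = E G (ind N) (ind B) := by
      rw [E_comm, E_ind]; push_cast; rfl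
    have h3 : E G (ind N) (ind B) ≤ (N.card : ℝ) * N.card := by
      rw [E_ind]
      have : ∀ u ∈ N, ((B.filter (G.Adj u)).card : ℝ) ≤ (N.card : ℝ) := by
        intro u _
        have h1 := Finset.card_le_card (Finset.filter_subset_filter (G.Adj u) (Finset.subset_univ B))
        exact_mod_cast h1.trans (hmax' u)
      have := Finset.sum_le_card_nsmul _ _ _ this
      rwa [nsmul_eq_mul] at this
    have h4 : ((∑ b ∈ B, jx b : ℕ) : ℝ) ≤ ((N.card * N.card : ℕ) : ℝ) := by
      rw [h2]; push_cast; exact h3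
    exact h1.trans (by exact_mod_cast h4)
  have hk116 : 116 ≤ N.card := by
    have c40 : C.card ≤ 40 := by
      by_contra hlt
      push Not at hlt
      nlinarith
    have bk : B.card ≤ N.card + 5 := by
      by_contra hlt
      push Not at hlt
      obtain ⟨m, hm⟩ := Nat.exists_eq_add_of_le hk36
      have : N.card - 5 = m + 31 := by omega
      rw [this] at hBk
      nlinarith
    omega
  have c11 : C.card ≤ 11 := by
    by_contra hlt
    push Not at hlt
    nlinarith
  have hB4 : ∀ b ∈ B, N.card ≤ jx b + 4 := by
    intro b hb
    by_cases hbv : b = v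
    · rw [hbv, jv]; omega
    obtain ⟨hbX, h5⟩ := BX b hb hbv
    have h1 := hcom b hbX
    by_contra hlt
    have h2 : jx b + 5 ≤ N.card := by omega
    have h3 : (jx b : ℝ) + 5 ≤ N.card := by exact_mod_cast h2
    have h4 : (5 : ℝ) ≤ jx b := by exact_mod_cast h5
    have h6 : (116 : ℝ) ≤ N.card := by exact_mod_cast hk116
    nlinarith [mul_nonneg (sub_nonneg.mpr h4) (sub_nonneg.mpr h3)]
  have hmiss : ∀ b ∈ B, (N.filter (fun y => ¬ G.Adj b y)).card ≤ 4 := by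
    intro b hb
    have h1 : jx b + (N.filter (fun y => ¬ G.Adj b y)).card = N.card :=
      Finset.card_filter_add_card_filter_not _
    have := hB4 b hb
    omega
  -- B and N are independent
  have indN : ∀ a ∈ N, ∀ b ∈ N, ¬ G.Adj a b := fun a ha b hb hab =>
    htf v a b ((memN a).mp ha) hab ((memN b).mp hb)
  have indB : ∀ a ∈ B, ∀ b ∈ B, ¬ G.Adj a b := by
    intro a ha b hb hab
    have : ∃ y ∈ N, G.Adj a y ∧ G.Adj b y := by
      by_contra hne
      push Not at hne
      have hsub : N ⊆ N.filter (fun y => ¬ G.Adj a y) ∪ N.filter (fun y => ¬ G.Adj b y) := by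
        intro y hy
        simp only [Finset.mem_union, Finset.mem_filter]
        have := hne y hy
        tauto
      have h1 := Finset.card_le_card hsub
      have h2 := Finset.card_union_le (N.filter (fun y => ¬ G.Adj a y))
        (N.filter (fun y => ¬ G.Adj b y))
      have := hmiss a ha
      have := hmiss b hb
      omega
    obtain ⟨y, -, h1, h2⟩ := this
    exact htf a b y hab h2 h1
  -- the switched graph
  let H : SimpleGraph {x // x ∉ C} :=
    { Adj := fun a b => ((a : V) ∈ B ∧ (b : V) ∈ N ∧ ¬ G.Adj a b) ∨
        ((a : V) ∈ N ∧ (b : V) ∈ B ∧ ¬ G.Adj a b)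
      symm := ⟨by
        intro a b hab
        rcases hab with ⟨h1, h2, h3⟩ | ⟨h1, h2, h3⟩
        · exact Or.inr ⟨h2, h1, fun h => h3 h.symm⟩
        · exact Or.inl ⟨h2, h1, fun h => h3 h.symm⟩⟩
      loopless := ⟨by
        intro a hab
        rcases hab with ⟨h1, h2, h3⟩ | ⟨h1, h2, h3⟩
        · exact ((memB _).mp h1).1 h2
        · exact ((memB _).mp h2).1 h1⟩ }
  have Hadj : ∀ a b : {x // x ∉ C}, H.Adj a b ↔ (((a : V) ∈ B ∧ (b : V) ∈ N ∧ ¬ G.Adj a b) ∨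
        ((a : V) ∈ N ∧ (b : V) ∈ B ∧ ¬ G.Adj a b)) := fun a b => Iff.rfl
  have notB : ∀ a : {x // x ∉ C}, (a : V) ∈ B ↔ (a : V) ∉ N := by
    intro a
    rw [memB]
    exact ⟨fun h => h.1, fun h => ⟨h, a.2⟩⟩
  set s : V → ℝ := fun x => if x ∈ N then 1 else -1 with hs
  have hss : ∀ x, s x * s x = 1 := by intro x; simp only [hs]; split_ifs <;> norm_num
  have hm : ∀ a b : {x // x ∉ C}, mat G a b = mat H a b * (s a * s b) := by
    intro a b
    have hab : ((a : V) = (b : V)) ↔ a = b := Subtype.ext_iff.symm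
    unfold mat
    rw [Hadj, notB, notB]
    simp only [hs, hab]
    by_cases ha : (a : V) ∈ N <;> by_cases hb : (b : V) ∈ N
    · have := indN a ha b hb
      simp [ha, hb, this]
    · have hne : a ≠ b := by rintro rfl; exact hb ha
      by_cases hg : G.Adj a b <;> simp [ha, hb, hg, hne] <;> norm_num
    · have hne : a ≠ b := by rintro rfl; exact ha hb
      by_cases hg : G.Adj a b <;> simp [ha, hb, hg, hne] <;> norm_num
    · have := indB a ((notB a).mpr ha) b ((notB b).mpr hb)
      simp [ha, hb, this]
  have htr := form_transfer G C H s hss hm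
  have hPH : PSD H := by
    intro y
    set z : V → ℝ := fun x => if hx : x ∉ C then s x * y ⟨x, hx⟩ else 0 with hz
    have hzC : ∀ x ∈ C, z x = 0 := by
      intro x hx; simp [hz, hx]
    have hzy : (fun a : {x // x ∉ C} => s a * z a) = y := by
      funext a
      have : z a = s a * y a := by simp only [hz]; rw [dif_pos a.2]
      rw [this, ← mul_assoc, hss, one_mul]
    have h1 := htr z hzC
    rw [show (∑ a : {x // x ∉ C}, s a * z a) = ∑ a, y a by rw [← hzy], hzy] at h1
    rw [← h1]
    exact h z
  have htfH : ∀ a b c, H.Adj a b → H.Adj b c → ¬ H.Adj a c := by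
    intro a b c
    rw [Hadj, Hadj, Hadj, notB, notB, notB]
    tauto
  have hdH : ∀ a, (univ.filter (H.Adj a)).card ≤ 4 := by
    -- missing neighbours of an element of B
    intro a
    by_cases ha : (a : V) ∈ N
    · by_contra hlt
      push Not at hlt
      obtain ⟨L, hLs, hL5⟩ := Finset.exists_subset_card_eq (Nat.succ_le_of_lt hlt)
      have hLadj : ∀ u ∈ L, H.Adj a u := fun u hu => by simpa using hLs hu
      have hLB : ∀ u ∈ L, (u : V) ∈ B := by
        intro u hu
        rcases hLadj u hu with ⟨h1, _⟩ | ⟨_, h1, _⟩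
        · exact absurd ha ((notB a).mp h1)
        · exact h1
      set Y : Finset {x // x ∉ C} :=
        univ.filter (fun y => (y : V) ∈ N ∧ y ≠ a ∧ ∀ u ∈ L, ¬ H.Adj u y) with hY
      have memY : ∀ y, y ∈ Y ↔ (y : V) ∈ N ∧ y ≠ a ∧ ∀ u ∈ L, ¬ H.Adj u y := by
        intro y; simp [hY]
      have hY45 : Y.card ≤ 45 := by
        refine k15_test H hPH a L Y hLadj hL5 ?_ ?_
        · intro y hy
          have hy := (memY y).mp hy
          refine ⟨hy.2.1, ?_, fun hyL => (notB y).mp (hLB y hyL) hy.1⟩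
          rw [Hadj, notB, notB]
          tauto
        · intro u hu y hy
          exact ((memY y).mp hy).2.2 u hu
      have hsub : N ⊆ Y.image Subtype.val ∪
          ({(a : V)} ∪ L.biUnion fun u => N.filter (fun y => ¬ G.Adj u y)) := by
        intro y hy
        have hyC : y ∉ C := Finset.disjoint_left.mp hNC hy
        by_cases hya : y = a
        · simp [hya]
        by_cases hex : ∃ u ∈ L, ¬ G.Adj u y
        · obtain ⟨u, hu, hg⟩ := hex
          refine Finset.mem_union_right _ (Finset.mem_union_right _ ?_)
          rw [Finset.mem_biUnion]
          exact ⟨u, hu, by simp [hy, hg]⟩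
        · push Not at hex
          refine Finset.mem_union_left _ ?_
          rw [Finset.mem_image]
          refine ⟨⟨y, hyC⟩, (memY _).mpr ⟨hy, ?_, ?_⟩, rfl⟩
          · intro e; exact hya (by rw [← e])
          · intro u hu
            have h1 := hex u hu
            rw [Hadj]
            simp only
            tauto
      have h1 := Finset.card_le_card hsub
      have h2 := Finset.card_union_le (Y.image Subtype.val)
          ({(a : V)} ∪ L.biUnion fun u => N.filter (fun y => ¬ G.Adj u y))
      have h3 := Finset.card_union_le {(a : V)}
          (L.biUnion fun u => N.filter (fun y => ¬ G.Adj u y))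
      have h4 : (L.biUnion fun u => N.filter (fun y => ¬ G.Adj u y)).card ≤ L.card * 4 :=
        Finset.card_biUnion_le_card_mul _ _ _ fun u hu => hmiss u (hLB u hu)
      have h5 : (Y.image Subtype.val).card ≤ Y.card := Finset.card_image_le
      rw [Finset.card_singleton] at h3
      omega
    · have haB := (notB a).mpr ha
      refine le_trans ?_ (hmiss a haB)
      rw [← Finset.card_image_of_injective (univ.filter (H.Adj a)) Subtype.val_injective]
      refine Finset.card_le_card ?_
      intro y hy
      rw [Finset.mem_image] at hy
      obtain ⟨b, hb, rfl⟩ := hy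
      have hb : H.Adj a b := by simpa using hb
      rw [Hadj] at hb
      rw [Finset.mem_filter]
      tauto
  obtain ⟨T, hT, hTz⟩ := low_main H hPH htfH (fun a => by convert hdH a)
  have hcardH : Fintype.card {x // x ∉ C} + C.card = Fintype.card V := by
    have h1 := Fintype.card_subtype_compl (fun x => x ∈ C)
    have h2 : Fintype.card {x // x ∈ C} = C.card := Fintype.card_coe C
    have h3 := Finset.card_le_univ C
    rw [h2] at h1
    omega
  refine ⟨C ∪ T.image Subtype.val, ?_, ?_⟩
  · have h1 := Finset.card_union_le C (T.image Subtype.val)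
    have h2 : (T.image Subtype.val).card ≤ T.card := Finset.card_image_le
    omega
  · intro z hz hform
    have hzC : ∀ x ∈ C, z x = 0 := fun x hx => hz x (Finset.mem_union_left _ hx)
    rw [htr z hzC] at hform
    have h1 := hTz (fun a => s a * z a) (by
      intro t ht
      have : z t = 0 := hz t (Finset.mem_union_right _ (Finset.mem_image_of_mem _ ht))
      simp [this]) hform
    funext x
    by_cases hx : x ∈ C
    · exact hzC x hx
    · have h2 : s x * z x = 0 := congrFun h1 ⟨x, hx⟩
      have h3 : s x ≠ 0 := fun h0 => by
        have := hss x
        rw [h0] at this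
        simp at this
      exact (mul_eq_zero.mp h2).resolve_left h3
end TF

/-! ### The final theorem -/
namespace TF

/-- Quadratic form expansion. -/
lemma quad_expand {n : ℕ} (M : Matrix (Fin n) (Fin n) ℝ) (x : Fin n → ℝ) :
    x ⬝ᵥ (M *ᵥ x) = ∑ u, ∑ v, M u v * (x u * x v) := by
  simp only [dotProduct, Matrix.mulVec, Finset.mul_sum]
  refine Finset.sum_congr rfl fun u _ => Finset.sum_congr rfl fun v _ => ?_
  ring

lemma psd_of_minEig {n : ℕ} (S : Matrix (Fin n) (Fin n) ℝ) (hS : IsSeidel S)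
    (hmin : minEig S = -5) (x : Fin n → ℝ) :
    0 ≤ x ⬝ᵥ ((S + (5 : ℝ) • (1 : Matrix (Fin n) (Fin n) ℝ)) *ᵥ x) := by
  have hA : S.IsHermitian := by
    have := hS.1
    rw [Matrix.IsHermitian, Matrix.conjTranspose_eq_transpose_of_trivial]
    exact this
  have hge : ∀ i, -5 ≤ hA.eigenvalues i := by
    intro i
    have h1 : minEig S = ⨅ i, hA.eigenvalues i := by
      unfold minEig
      rw [dif_pos hA]
    rw [← hmin, h1]
    exact ciInf_le (Set.finite_range _).bddBelow i
  have hH : (S + (5 : ℝ) • (1 : Matrix (Fin n) (Fin n) ℝ)).IsHermitian := by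
    refine hA.add ?_
    rw [Matrix.IsHermitian]
    simp
  have hp : (S + (5 : ℝ) • (1 : Matrix (Fin n) (Fin n) ℝ)).PosSemidef := by
    rw [Matrix.posSemidef_iff_isHermitian_and_spectrum_nonneg]
    refine ⟨hH, ?_⟩
    have he : (S + (5 : ℝ) • (1 : Matrix (Fin n) (Fin n) ℝ)) =
        S + algebraMap ℝ (Matrix (Fin n) (Fin n) ℝ) 5 := by
      rw [Algebra.algebraMap_eq_smul_one]
    rw [he, ← spectrum.add_singleton_eq, hA.spectrum_real_eq_range_eigenvalues]
    rintro _ ⟨_, ⟨i, rfl⟩, _, rfl, rfl⟩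
    have := hge i
    show (0 : ℝ) ≤ hA.eigenvalues i + 5
    linarith
  simpa using hp.dotProduct_mulVec_nonneg x

end TF

/-- If `S` is a Seidel matrix of order `n ≥ 277` with smallest eigenvalue
exactly `-5` whose switching class contains a triangle-free graph `G`
(i.e. `S(G) = D S D` for some diagonal `±1` matrix `D`), then `rk(S + 5I) ≥ 2n/3 + 1`. -/
theorem stmt_5 {n : ℕ} (S : Matrix (Fin n) (Fin n) ℝ) (hS : IsSeidel S)
    (hmin : minEig S = -5) (hn : 277 ≤ n)
    (G : SimpleGraph (Fin n)) (htf : G.CliqueFree 3)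
    (hsw : SwEquiv S (seidelOf G)) :
    2 * (n : ℝ) / 3 + 1 ≤ ((S + (5 : ℝ) • 1).rank : ℝ) := by
  obtain ⟨ε, hε, hG⟩ := hsw
  set M := S + (5 : ℝ) • (1 : Matrix (Fin n) (Fin n) ℝ) with hM
  have hsq : ∀ i, ε i * ε i = 1 := by
    intro i
    rcases hε i with h | h <;> rw [h] <;> norm_num
  have hmat : ∀ i j, TF.mat G i j = ε i * M i j * ε j := by
    intro i j
    have h1 : seidelOf G i j = ε i * S i j * ε j := by
      rw [hG, Matrix.mul_diagonal, Matrix.diagonal_mul]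
    have h2 : TF.mat G i j = seidelOf G i j + if i = j then 5 else 0 := by
      unfold TF.mat seidelOf
      by_cases hij : i = j
      · subst hij
        simp
        norm_num
      · by_cases ha : G.Adj i j
        · simp [hij, ha]
          norm_num
        · simp [hij, ha]
    rw [h2, h1, hM]
    by_cases hij : i = j
    · subst hij
      simp
      linear_combination (-5) * hsq i
    · simp [hij]
  have hform : ∀ z : Fin n → ℝ, (∑ v, z v) ^ 2 + 2 * TF.Q G z =
      (fun i => ε i * z i) ⬝ᵥ (M *ᵥ (fun i => ε i * z i)) := by
    intro z
    rw [TF.form_eq, TF.quad_expand]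
    refine Finset.sum_congr rfl fun u _ => Finset.sum_congr rfl fun v _ => ?_
    rw [hmat]
    ring
  have hpsd : TF.PSD G := by
    intro y
    rw [hform]
    exact TF.psd_of_minEig S hS hmin _
  have htri : ∀ a b c, G.Adj a b → G.Adj b c → ¬ G.Adj a c := by
    intro a b c hab hbc hac
    exact htf {a, b, c} (SimpleGraph.is3Clique_triple_iff.mpr ⟨hab, hac, hbc⟩)
  obtain ⟨T, hT, hTz⟩ := TF.core G hpsd htri (by simpa using hn)
  rw [Fintype.card_fin] at hT
  have hker : ∀ u : Fin n → ℝ, M *ᵥ u = 0 → (∀ t ∈ T, u t = 0) → u = 0 := by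
    intro u hu h0
    have h1 := hTz (fun i => ε i * u i) (fun t ht => by simp [h0 t ht]) (by
      rw [hform]
      have : (fun i => ε i * (ε i * u i)) = u := by
        funext i
        rw [← mul_assoc, hsq, one_mul]
      rw [this, hu]
      simp)
    funext i
    have h2 : ε i * u i = 0 := congrFun h1 i
    have h3 := hsq i
    have : u i = ε i * (ε i * u i) := by rw [← mul_assoc, hsq, one_mul]
    rw [this, h2]
    simp
  let R : LinearMap.ker M.mulVecLin →ₗ[ℝ] (T → ℝ) :=
    (LinearMap.funLeft ℝ ℝ (fun t : T => (t : Fin n))).comp (LinearMap.ker M.mulVecLin).subtype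
  have hR : Function.Injective R := by
    rw [← LinearMap.ker_eq_bot, LinearMap.ker_eq_bot']
    rintro ⟨u, hu⟩ hRu
    have hu' : M *ᵥ u = 0 := by simpa using hu
    have : u = 0 := hker u hu' (fun t ht => by
      have := congrFun hRu ⟨t, ht⟩
      simpa [R, LinearMap.funLeft] using this)
    exact Subtype.ext this
  have hle := LinearMap.finrank_le_finrank_of_injective hR
  rw [Module.finrank_fintype_fun_eq_card, Fintype.card_coe] at hle
  have hrn := LinearMap.finrank_range_add_finrank_ker M.mulVecLin
  rw [Module.finrank_fintype_fun_eq_card, Fintype.card_fin] at hrn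
  have hrank : M.rank = Module.finrank ℝ (LinearMap.range M.mulVecLin) := rfl
  have hfin : 2 * n + 3 ≤ 3 * M.rank := by omega
  have hfin' : 2 * (n : ℝ) + 3 ≤ 3 * (M.rank : ℝ) := by exact_mod_cast hfin
  linarith
end
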